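/- (Three spheres inequality for L_q) For every Λ > 0 there exist N > 0 and s ∈ (0,1), depending only on n, Ω, A and Λ, such that: for every measurable q with ‖q‖_{L^∞(Ω)} ≤ Λ, every classical solution w ∈ C²(Ω) of L_q w = 0, every y ∈ Ω and every r with 0 < r < dist(y, ∂Ω)/3, one has r ‖w‖_{H¹(B(y,2r))} ≤ N ‖w‖_{H¹(B(y,r))}^{s} ‖w‖_{H¹(B(y,3r))}^{1−s}. -/

import Mathlib

open MeasureTheory Metric Set
open scoped RealInnerProductSpace

noncomputable section

/-- The `i`-th partial derivative of a real-valued function on `ℝⁿ`. -/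
noncomputable def pd {n : ℕ} (i : Fin n) (f : EuclideanSpace ℝ (Fin n) → ℝ)
    (x : EuclideanSpace ℝ (Fin n)) : ℝ :=
  fderiv ℝ f x (EuclideanSpace.single i 1)

/-- `u` is a classical solution of `L_q u = ∑ᵢⱼ ∂ᵢ (aⁱʲ ∂ⱼ u) + q u = 0` pointwise in `Ω`. -/
def IsSolution {n : ℕ} (A : Fin n → Fin n → EuclideanSpace ℝ (Fin n) → ℝ)
    (q u : EuclideanSpace ℝ (Fin n) → ℝ) (Ω : Set (EuclideanSpace ℝ (Fin n))) : Prop :=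
  ∀ x ∈ Ω, (∑ i, ∑ j, pd i (fun y => A i j y * pd j u y) x) + q x * u x = 0

/-- The `H¹(D)` norm `(∫_D (w² + ‖∇w‖²))^{1/2}`. -/
noncomputable def H1Norm {n : ℕ} (D : Set (EuclideanSpace ℝ (Fin n)))
    (w : EuclideanSpace ℝ (Fin n) → ℝ) : ℝ :=
  (∫ x in D, ((w x) ^ 2 + ‖fderiv ℝ w x‖ ^ 2)) ^ (1 / 2 : ℝ)

/-- `A = (aⁱʲ)` is symmetric, has `C¹` entries on `closure Ω`, and is uniformly elliptic. -/
def EllipticSym {n : ℕ} (Ω : Set (EuclideanSpace ℝ (Fin n)))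
    (A : Fin n → Fin n → EuclideanSpace ℝ (Fin n) → ℝ) : Prop :=
  (∀ i j, ∀ x ∈ closure Ω, A i j x = A j i x) ∧
  (∀ i j, ContDiffOn ℝ 1 (A i j) (closure Ω)) ∧
  (∃ lam > 0, ∀ x ∈ Ω, ∀ ξ : EuclideanSpace ℝ (Fin n),
    lam * ‖ξ‖ ^ 2 ≤ ∑ i, ∑ j, A i j x * ξ i * ξ j)

section Helpers

variable {n : ℕ}

theorem pd_mul {f g : EuclideanSpace ℝ (Fin n) → ℝ} {x} (i : Fin n)
    (hf : DifferentiableAt ℝ f x) (hg : DifferentiableAt ℝ g x) :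
    pd i (fun y => f y * g y) x = pd i f x * g x + f x * pd i g x := by
  unfold pd
  rw [fderiv_fun_mul hf hg]
  simp; ring

theorem pd_add {f g : EuclideanSpace ℝ (Fin n) → ℝ} {x} (i : Fin n)
    (hf : DifferentiableAt ℝ f x) (hg : DifferentiableAt ℝ g x) :
    pd i (fun y => f y + g y) x = pd i f x + pd i g x := by
  unfold pd
  rw [fderiv_fun_add hf hg]
  simp

theorem pd_sub {f g : EuclideanSpace ℝ (Fin n) → ℝ} {x} (i : Fin n)
    (hf : DifferentiableAt ℝ f x) (hg : DifferentiableAt ℝ g x) :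
    pd i (fun y => f y - g y) x = pd i f x - pd i g x := by
  unfold pd
  rw [fderiv_fun_sub hf hg]
  simp

theorem pd_const_mul {f : EuclideanSpace ℝ (Fin n) → ℝ} {x} (i : Fin n) (c : ℝ)
    (hf : DifferentiableAt ℝ f x) :
    pd i (fun y => c * f y) x = c * pd i f x := by
  unfold pd
  rw [fderiv_const_mul hf]
  simp

theorem pd_sum {ι : Type*} {s : Finset ι} {f : ι → EuclideanSpace ℝ (Fin n) → ℝ} {x} (i : Fin n)
    (hf : ∀ j ∈ s, DifferentiableAt ℝ (f j) x) :
    pd i (fun y => ∑ j ∈ s, f j y) x = ∑ j ∈ s, pd i (f j) x := by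
  unfold pd
  rw [fderiv_fun_sum hf]
  simp

theorem pd_exp {f : EuclideanSpace ℝ (Fin n) → ℝ} {x} (i : Fin n)
    (hf : DifferentiableAt ℝ f x) :
    pd i (fun y => Real.exp (f y)) x = Real.exp (f x) * pd i f x := by
  unfold pd
  rw [fderiv_exp hf]
  simp

theorem pd_coord {x} (i j : Fin n) :
    pd i (fun y : EuclideanSpace ℝ (Fin n) => y j) x = if i = j then 1 else 0 := by
  unfold pd
  have : (fun y : EuclideanSpace ℝ (Fin n) => y j) =
    (EuclideanSpace.proj j : EuclideanSpace ℝ (Fin n) →L[ℝ] ℝ) := by ext; simp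
  rw [this, ContinuousLinearMap.fderiv]
  simp [eq_comm]

theorem contDiff_pd {f : EuclideanSpace ℝ (Fin n) → ℝ} (i : Fin n) (m : ℕ∞)
    (hf : ContDiff ℝ (m + 1) f) : ContDiff ℝ m (pd i f) := by
  unfold pd
  have := hf.fderiv_right (m := m) le_rfl
  exact this.clm_apply contDiff_const

theorem contDiff_pd1 {f : EuclideanSpace ℝ (Fin n) → ℝ} (i : Fin n)
    (hf : ContDiff ℝ 2 f) : ContDiff ℝ 1 (pd i f) :=
  contDiff_pd i 1 (by norm_num; exact hf)

theorem continuous_pd {f : EuclideanSpace ℝ (Fin n) → ℝ} (i : Fin n)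
    (hf : ContDiff ℝ 1 f) : Continuous (pd i f) :=
  (contDiff_pd i 0 (by simpa using hf)).continuous

theorem pd_comm {f : EuclideanSpace ℝ (Fin n) → ℝ} (hf : ContDiff ℝ 2 f) (i j : Fin n) (x) :
    pd i (pd j f) x = pd j (pd i f) x := by
  have h := (hf.contDiffAt (x := x)).isSymmSndFDerivAt (by simp)
  have hd : DifferentiableAt ℝ (fderiv ℝ f) x :=
    ((hf.fderiv_right (m := 1) (by norm_num)).differentiable (by norm_num)) x
  have key : ∀ i j : Fin n, pd i (pd j f) x =
      fderiv ℝ (fderiv ℝ f) x (EuclideanSpace.single i 1) (EuclideanSpace.single j 1) := by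
    intro i j
    unfold pd
    rw [fderiv_clm_apply hd (differentiableAt_const _)]
    simp
  rw [key, key]
  exact h.eq _ _

theorem hasCompactSupport_pd {f : EuclideanSpace ℝ (Fin n) → ℝ} (i : Fin n)
    (hf : HasCompactSupport f) : HasCompactSupport (pd i f) :=
  (hf.fderiv_apply ℝ _)

theorem integral_pd_zero {f : EuclideanSpace ℝ (Fin n) → ℝ} (i : Fin n)
    (hf : ContDiff ℝ 1 f) (hc : HasCompactSupport f) : ∫ x, pd i f x = 0 := by
  have h := integral_mul_fderiv_eq_neg_fderiv_mul_of_integrable (𝕜 := ℝ) (f := fun _ => (1:ℝ)) (g := f)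
    (v := EuclideanSpace.single i 1) (μ := volume) ?_ ?_ ?_ ?_ ?_
  · simpa [pd] using h
  · simp
  · have := (continuous_pd i hf).integrable_of_hasCompactSupport (μ := volume) (hasCompactSupport_pd i hc)
    simp only [one_mul]
    exact this
  · simpa using hf.continuous.integrable_of_hasCompactSupport hc
  · fun_prop
  · exact fun x _ => (hf.differentiable (by norm_num)) x

theorem norm_fderiv_sq (f : EuclideanSpace ℝ (Fin n) → ℝ) (x) :
    ‖fderiv ℝ f x‖ ^ 2 = ∑ i, (pd i f x) ^ 2 := by
  set v := (InnerProductSpace.toDual ℝ (EuclideanSpace ℝ (Fin n))).symm (fderiv ℝ f x) with hv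
  have h1 : ‖fderiv ℝ f x‖ = ‖v‖ := by rw [hv, LinearIsometryEquiv.norm_map]
  rw [h1, EuclideanSpace.norm_sq_eq]
  refine Finset.sum_congr rfl fun i _ => ?_
  have : pd i f x = v i := by
    unfold pd
    rw [← InnerProductSpace.toDual_symm_apply, ← hv]
    simp [EuclideanSpace.inner_single_right]
  rw [this]; simp

/-- the divergence form operator -/
def Lop (a : Fin n → Fin n → EuclideanSpace ℝ (Fin n) → ℝ) (u : EuclideanSpace ℝ (Fin n) → ℝ)
    (x : EuclideanSpace ℝ (Fin n)) : ℝ := ∑ i, ∑ j, pd i (fun y => a i j y * pd j u y) x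

theorem Lop_mul {a : Fin n → Fin n → EuclideanSpace ℝ (Fin n) → ℝ}
    (ha : ∀ i j, ContDiff ℝ 1 (a i j)) {h u : EuclideanSpace ℝ (Fin n) → ℝ}
    (hh : ContDiff ℝ 2 h) (hu : ContDiff ℝ 2 u) (x) :
    Lop a (fun y => h y * u y) x = h x * Lop a u x
      + (∑ i, ∑ j, a i j x * (pd i h x * pd j u x + pd j h x * pd i u x)) + u x * Lop a h x := by
  unfold Lop
  simp only [Finset.mul_sum, ← Finset.sum_add_distrib]
  refine Finset.sum_congr rfl fun i _ => Finset.sum_congr rfl fun j _ => ?_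
  have dh : Differentiable ℝ h := hh.differentiable (by norm_num)
  have du : Differentiable ℝ u := hu.differentiable (by norm_num)
  have da : Differentiable ℝ (a i j) := (ha i j).differentiable (by norm_num)
  have dhj : Differentiable ℝ (pd j h) := (contDiff_pd1 j hh).differentiable (by norm_num)
  have duj : Differentiable ℝ (pd j u) := (contDiff_pd1 j hu).differentiable (by norm_num)
  have e : (fun y => a i j y * pd j (fun y => h y * u y) y) =
      fun y => h y * (a i j y * pd j u y) + u y * (a i j y * pd j h y) := by
    ext y
    rw [pd_mul j (dh y) (du y)]; ring
  rw [e, pd_add i (by fun_prop) (by fun_prop),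
    pd_mul (f := h) (g := fun y => a i j y * pd j u y) i (by fun_prop) (by fun_prop),
    pd_mul (f := u) (g := fun y => a i j y * pd j h y) i (by fun_prop) (by fun_prop)]
  ring

/-- purely algebraic part of the divergence identity -/
theorem div_alg (a : Fin n → Fin n → ℝ) (hs : ∀ i j, a i j = a j i)
    (H : Fin n → Fin n → ℝ) (hH : ∀ i j, H i j = H j i)
    (p β : Fin n → ℝ) :
    ∑ i, (∑ j, a i j * p j) * (2 * ∑ k, β k * H i k)
      = ∑ i, β i * ∑ j, ∑ k, (a j k * (H i j * p k + p j * H i k)) := by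
  have e1 : ∑ i, (∑ j, a i j * p j) * (2 * ∑ k, β k * H i k) =
      ∑ k, β k * ∑ i, ∑ j, 2 * (a i j * p j * H k i) := by
    simp only [Finset.mul_sum, Finset.sum_mul]
    rw [Finset.sum_comm]
    refine Finset.sum_congr rfl fun k _ => ?_
    refine Finset.sum_congr rfl fun i _ => ?_
    refine Finset.sum_congr rfl fun j _ => ?_
    rw [hH k i]; ring
  rw [e1]
  refine Finset.sum_congr rfl fun k _ => ?_
  congr 1
  have e2 : ∑ i, ∑ j, a i j * p j * H k i = ∑ i, ∑ j, a i j * p i * H k j := by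
    rw [Finset.sum_comm]
    refine Finset.sum_congr rfl fun i _ => Finset.sum_congr rfl fun j _ => ?_
    rw [hs j i]
  calc _ = ∑ i, ∑ j, a i j * p j * H k i + ∑ i, ∑ j, a i j * p j * H k i := by
        simp only [← Finset.mul_sum]; ring
    _ = ∑ i, ∑ j, a i j * p j * H k i + ∑ i, ∑ j, a i j * p i * H k j := by rw [← e2]
    _ = _ := by
      simp only [← Finset.sum_add_distrib]
      refine Finset.sum_congr rfl fun i _ => Finset.sum_congr rfl fun j _ => ?_
      ring

def Qf (β : Fin n → EuclideanSpace ℝ (Fin n) → ℝ) (g u : EuclideanSpace ℝ (Fin n) → ℝ)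
    (x : EuclideanSpace ℝ (Fin n)) : ℝ := 2 * (∑ k, β k x * pd k u x) + g x * u x

def Ff (a : Fin n → Fin n → EuclideanSpace ℝ (Fin n) → ℝ)
    (β : Fin n → EuclideanSpace ℝ (Fin n) → ℝ) (g b u : EuclideanSpace ℝ (Fin n) → ℝ) (t : ℝ)
    (i : Fin n) (x : EuclideanSpace ℝ (Fin n)) : ℝ :=
  (∑ j, a i j x * pd j u x) * Qf β g u x - β i x * (∑ j, ∑ k, a j k x * (pd j u x * pd k u x))
    + (t * (b x * β i x)) * (u x * u x)

def Rf (a : Fin n → Fin n → EuclideanSpace ℝ (Fin n) → ℝ)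
    (β : Fin n → EuclideanSpace ℝ (Fin n) → ℝ) (g b u : EuclideanSpace ℝ (Fin n) → ℝ) (t : ℝ)
    (x : EuclideanSpace ℝ (Fin n)) : ℝ :=
  2 * (∑ i, (∑ j, a i j x * pd j u x) * (∑ k, pd i (β k) x * pd k u x))
  - (∑ i, pd i (β i) x) * (∑ j, ∑ k, a j k x * (pd j u x * pd k u x))
  - (∑ i, β i x * (∑ j, ∑ k, pd i (a j k) x * (pd j u x * pd k u x)))
  + g x * (∑ j, ∑ k, a j k x * (pd j u x * pd k u x))
  + u x * (∑ i, (∑ j, a i j x * pd j u x) * pd i g x)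
  + t * ((∑ i, pd i (fun y => b y * β i y) x) - g x * b x) * u x ^ 2

theorem div_identity {a : Fin n → Fin n → EuclideanSpace ℝ (Fin n) → ℝ}
    (ha : ∀ i j, ContDiff ℝ 1 (a i j)) (hs : ∀ i j x, a i j x = a j i x)
    {β : Fin n → EuclideanSpace ℝ (Fin n) → ℝ} (hβ : ∀ i, ContDiff ℝ 1 (β i))
    {g b u : EuclideanSpace ℝ (Fin n) → ℝ} (hg : ContDiff ℝ 1 g) (hb : ContDiff ℝ 1 b)
    (hu : ContDiff ℝ 2 u) (t : ℝ) (x) :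
    (Lop a u x + t * b x * u x) * Qf β g u x = (∑ i, pd i (Ff a β g b u t i) x) - Rf a β g b u t x := by
  have du : Differentiable ℝ u := hu.differentiable (by norm_num)
  have da : ∀ i j, Differentiable ℝ (a i j) := fun i j => (ha i j).differentiable (by norm_num)
  have dβ : ∀ i, Differentiable ℝ (β i) := fun i => (hβ i).differentiable (by norm_num)
  have dg : Differentiable ℝ g := hg.differentiable (by norm_num)
  have db : Differentiable ℝ b := hb.differentiable (by norm_num)
  have dp : ∀ j, Differentiable ℝ (pd j u) :=
    fun j => (contDiff_pd1 j hu).differentiable (by norm_num)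
  have dQ : Differentiable ℝ (Qf β g u) := by unfold Qf; fun_prop
  have pQ : ∀ i, pd i (Qf β g u) x = 2 * (∑ k, β k x * pd i (pd k u) x)
      + 2 * (∑ k, pd i (β k) x * pd k u x) + (pd i g x * u x + g x * pd i u x) := by
    intro i
    unfold Qf
    rw [pd_add i (by fun_prop) (by fun_prop), pd_mul (f := g) i (by fun_prop) (by fun_prop),
      pd_const_mul i _ (by fun_prop), pd_sum i (fun j _ => by fun_prop)]
    have : ∀ k, pd i (fun y => β k y * pd k u y) x
        = pd i (β k) x * pd k u x + β k x * pd i (pd k u) x := fun k =>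
      pd_mul i (by fun_prop) (by fun_prop)
    simp only [this, Finset.sum_add_distrib]
    ring
  have pA : ∀ i, pd i (fun y => ∑ j, ∑ k, a j k y * (pd j u y * pd k u y)) x =
      (∑ j, ∑ k, pd i (a j k) x * (pd j u x * pd k u x)) +
      ∑ j, ∑ k, (a j k x * (pd i (pd j u) x * pd k u x + pd j u x * pd i (pd k u) x)) := by
    intro i
    rw [pd_sum i (fun j _ => by fun_prop), ← Finset.sum_add_distrib]
    refine Finset.sum_congr rfl fun j _ => ?_
    rw [pd_sum i (fun j _ => by fun_prop), ← Finset.sum_add_distrib]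
    refine Finset.sum_congr rfl fun k _ => ?_
    rw [pd_mul (f := a j k) (g := fun y => pd j u y * pd k u y) i (by fun_prop) (by fun_prop),
      pd_mul i (by fun_prop) (by fun_prop)]
  have pF : ∀ i, pd i (Ff a β g b u t i) x =
      (∑ j, pd i (fun y => a i j y * pd j u y) x) * Qf β g u x
      + (∑ j, a i j x * pd j u x) * pd i (Qf β g u) x
      - pd i (β i) x * (∑ j, ∑ k, a j k x * (pd j u x * pd k u x))
      - β i x * pd i (fun y => ∑ j, ∑ k, a j k y * (pd j u y * pd k u y)) x
      + (t * pd i (fun y => b y * β i y) x) * u x ^ 2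
      + 2 * t * b x * u x * (β i x * pd i u x) := by
    intro i
    unfold Ff
    rw [pd_add i (by fun_prop) (by fun_prop), pd_sub i (by fun_prop) (by fun_prop),
      pd_mul (g := Qf β g u) i (by fun_prop) (by fun_prop),
      pd_mul (f := β i) i (by fun_prop) (by fun_prop),
      pd_mul (g := fun y => u y * u y) i (by fun_prop) (by fun_prop),
      pd_const_mul i _ (by fun_prop), pd_sum i (fun j _ => by fun_prop),
      pd_mul (f := u) (g := u) i (by fun_prop) (by fun_prop)]
    ring
  have key := div_alg (fun i j => a i j x) (fun i j => hs i j x)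
    (fun i j => pd i (pd j u) x) (fun i j => pd_comm hu i j x) (fun i => pd i u x) (fun i => β i x)
  have hap : ∑ j, ∑ k, a j k x * (pd j u x * pd k u x) = ∑ i, (∑ j, a i j x * pd j u x) * pd i u x := by
    refine Finset.sum_congr rfl fun i _ => ?_
    rw [Finset.sum_mul]
    refine Finset.sum_congr rfl fun j _ => ?_
    ring
  have tot : (∑ i, pd i (Ff a β g b u t i) x) =
      Lop a u x * Qf β g u x
      + (∑ i, (∑ j, a i j x * pd j u x) * (2 * ∑ k, β k x * pd i (pd k u) x))
      + 2 * (∑ i, (∑ j, a i j x * pd j u x) * (∑ k, pd i (β k) x * pd k u x))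
      + u x * (∑ i, (∑ j, a i j x * pd j u x) * pd i g x)
      + g x * (∑ i, (∑ j, a i j x * pd j u x) * pd i u x)
      - (∑ i, pd i (β i) x) * (∑ j, ∑ k, a j k x * (pd j u x * pd k u x))
      - (∑ i, β i x * (∑ j, ∑ k, pd i (a j k) x * (pd j u x * pd k u x)))
      - (∑ i, β i x * ∑ j, ∑ k, (a j k x * (pd i (pd j u) x * pd k u x + pd j u x * pd i (pd k u) x)))
      + t * (∑ i, pd i (fun y => b y * β i y) x) * u x ^ 2
      + 2 * t * b x * u x * (∑ i, (β i x * pd i u x)) := by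
    unfold Lop
    have e : ∀ i, pd i (Ff a β g b u t i) x = 
      (∑ j, pd i (fun y => a i j y * pd j u y) x) * Qf β g u x
      + ((∑ j, a i j x * pd j u x) * (2 * ∑ k, β k x * pd i (pd k u) x))
      + 2 * ((∑ j, a i j x * pd j u x) * (∑ k, pd i (β k) x * pd k u x))
      + u x * ((∑ j, a i j x * pd j u x) * pd i g x)
      + g x * ((∑ j, a i j x * pd j u x) * pd i u x)
      - (pd i (β i) x) * (∑ j, ∑ k, a j k x * (pd j u x * pd k u x))
      - (β i x * (∑ j, ∑ k, pd i (a j k) x * (pd j u x * pd k u x)))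
      - (β i x * ∑ j, ∑ k, (a j k x * (pd i (pd j u) x * pd k u x + pd j u x * pd i (pd k u) x)))
      + t * (pd i (fun y => b y * β i y) x) * u x ^ 2
      + 2 * t * b x * u x * (β i x * pd i u x) := by
      intro i
      rw [pF, pQ, pA]; ring
    rw [Finset.sum_congr rfl fun i _ => e i]
    simp only [Finset.sum_add_distrib, Finset.sum_sub_distrib, ← Finset.mul_sum, ← Finset.sum_mul]
  rw [tot, key, ← hap]
  unfold Rf Qf
  ring

theorem contDiff_Qf {β : Fin n → EuclideanSpace ℝ (Fin n) → ℝ} (hβ : ∀ i, ContDiff ℝ 1 (β i))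
    {g u : EuclideanSpace ℝ (Fin n) → ℝ} (hg : ContDiff ℝ 1 g) 
    (hu : ContDiff ℝ 2 u) : ContDiff ℝ 1 (Qf β g u) := by
  have := fun j => contDiff_pd1 j hu
  have hu1 : ContDiff ℝ 1 u := hu.of_le (by norm_num)
  unfold Qf
  fun_prop

theorem contDiff_Ff {a : Fin n → Fin n → EuclideanSpace ℝ (Fin n) → ℝ}
    (ha : ∀ i j, ContDiff ℝ 1 (a i j)) 
    {β : Fin n → EuclideanSpace ℝ (Fin n) → ℝ} (hβ : ∀ i, ContDiff ℝ 1 (β i))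
    {g b u : EuclideanSpace ℝ (Fin n) → ℝ} (hg : ContDiff ℝ 1 g) (hb : ContDiff ℝ 1 b)
    (hu : ContDiff ℝ 2 u) (t : ℝ) (i) : ContDiff ℝ 1 (Ff a β g b u t i) := by
  have := fun j => contDiff_pd1 j hu
  have hu1 : ContDiff ℝ 1 u := hu.of_le (by norm_num)
  have := contDiff_Qf hβ hg hu
  unfold Ff
  fun_prop

theorem integral_div_zero {a : Fin n → Fin n → EuclideanSpace ℝ (Fin n) → ℝ}
    (ha : ∀ i j, ContDiff ℝ 1 (a i j)) 
    {β : Fin n → EuclideanSpace ℝ (Fin n) → ℝ} (hβ : ∀ i, ContDiff ℝ 1 (β i))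
    {g b u : EuclideanSpace ℝ (Fin n) → ℝ} (hg : ContDiff ℝ 1 g) (hb : ContDiff ℝ 1 b)
    (hu : ContDiff ℝ 2 u) (hc : HasCompactSupport u) (t : ℝ) :
    Integrable (fun x => ∑ i, pd i (Ff a β g b u t i) x) ∧
    ∫ x, (∑ i, pd i (Ff a β g b u t i) x) = 0 := by
  have hF := contDiff_Ff ha hβ hg hb hu t
  have hcF : ∀ i, HasCompactSupport (Ff a β g b u t i) := by
    intro i
    refine hc.mono' ?_
    intro x hx
    by_contra hxn
    apply hx
    have h1 : ∀ j, pd j u x = 0 := by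
      intro j
      unfold pd
      rw [fderiv_of_notMem_tsupport ℝ hxn]; simp
    have h0 : u x = 0 := image_eq_zero_of_notMem_tsupport hxn
    simp [Ff, h1, h0]
  have hi : ∀ i, Integrable (pd i (Ff a β g b u t i)) := fun i =>
    (continuous_pd i (hF i)).integrable_of_hasCompactSupport (hasCompactSupport_pd i (hcF i))
  constructor
  · exact integrable_finsetSum _ fun i _ => hi i
  · rw [integral_finsetSum _ fun i _ => hi i]
    exact Finset.sum_eq_zero fun i _ => integral_pd_zero i (hF i) (hcF i)


def phi (α : ℝ) (x : EuclideanSpace ℝ (Fin n)) : ℝ := Real.exp (-α * ∑ j, x j * x j)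
def gam (a : Fin n → Fin n → EuclideanSpace ℝ (Fin n) → ℝ) (k : Fin n)
    (x : EuclideanSpace ℝ (Fin n)) : ℝ := ∑ j, a k j x * x j
def cf (a : Fin n → Fin n → EuclideanSpace ℝ (Fin n) → ℝ)
    (x : EuclideanSpace ℝ (Fin n)) : ℝ := ∑ k, gam a k x * x k
def bet (α : ℝ) (a : Fin n → Fin n → EuclideanSpace ℝ (Fin n) → ℝ) (k : Fin n)
    (x : EuclideanSpace ℝ (Fin n)) : ℝ := (-2 * α) * (phi α x * gam a k x)
def bfun (α : ℝ) (a : Fin n → Fin n → EuclideanSpace ℝ (Fin n) → ℝ)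
    (x : EuclideanSpace ℝ (Fin n)) : ℝ := (4 * α ^ 2) * ((phi α x * phi α x) * cf a x)
def gfun (α : ℝ) (a : Fin n → Fin n → EuclideanSpace ℝ (Fin n) → ℝ)
    (x : EuclideanSpace ℝ (Fin n)) : ℝ := (8 * α ^ 2) * (phi α x * cf a x)

theorem contDiff_coord {m : WithTop ℕ∞} (j : Fin n) :
    ContDiff ℝ m (fun x : EuclideanSpace ℝ (Fin n) => x j) := by fun_prop

theorem contDiff_phi (α : ℝ) {m : WithTop ℕ∞} : ContDiff ℝ m (phi (n := n) α) := by
  unfold phi; fun_prop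


theorem contDiff_gam {a : Fin n → Fin n → EuclideanSpace ℝ (Fin n) → ℝ}
    (ha : ∀ i j, ContDiff ℝ 1 (a i j)) (k) : ContDiff ℝ 1 (gam a k) := by
  unfold gam; fun_prop
theorem contDiff_cf {a : Fin n → Fin n → EuclideanSpace ℝ (Fin n) → ℝ}
    (ha : ∀ i j, ContDiff ℝ 1 (a i j)) : ContDiff ℝ 1 (cf a) := by
  have := contDiff_gam ha
  unfold cf; fun_prop
theorem contDiff_bet {a : Fin n → Fin n → EuclideanSpace ℝ (Fin n) → ℝ}
    (ha : ∀ i j, ContDiff ℝ 1 (a i j)) (α : ℝ) (k) : ContDiff ℝ 1 (bet α a k) := by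
  have := contDiff_gam ha k
  have := contDiff_phi (n := n) α (m := 1)
  unfold bet; fun_prop
theorem contDiff_bfun {a : Fin n → Fin n → EuclideanSpace ℝ (Fin n) → ℝ}
    (ha : ∀ i j, ContDiff ℝ 1 (a i j)) (α : ℝ) : ContDiff ℝ 1 (bfun α a) := by
  have := contDiff_cf ha
  have := contDiff_phi (n := n) α (m := 1)
  unfold bfun; fun_prop
theorem contDiff_gfun {a : Fin n → Fin n → EuclideanSpace ℝ (Fin n) → ℝ}
    (ha : ∀ i j, ContDiff ℝ 1 (a i j)) (α : ℝ) : ContDiff ℝ 1 (gfun α a) := by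
  have := contDiff_cf ha
  have := contDiff_phi (n := n) α (m := 1)
  unfold gfun; fun_prop

theorem pd_phi (α : ℝ) (i : Fin n) (x) : pd i (phi α) x = -2 * α * x i * phi α x := by
  unfold phi
  rw [pd_exp i (by fun_prop), pd_const_mul i _ (by fun_prop), pd_sum i (fun j _ => by fun_prop)]
  have : ∀ j, pd i (fun y : EuclideanSpace ℝ (Fin n) => y j * y j) x = if i = j then 2 * x j else 0 := by
    intro j
    rw [pd_mul i (by fun_prop) (by fun_prop), pd_coord]
    split_ifs <;> ring
  simp only [this, Finset.sum_ite_eq, Finset.mem_univ, if_true]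
  ring

theorem abs_sum_le_card {f : Fin n → ℝ} {B : ℝ} (h : ∀ i, |f i| ≤ B) : |∑ i, f i| ≤ n * B := by
  refine (Finset.abs_sum_le_sum_abs _ _).trans ?_
  refine (Finset.sum_le_sum fun i _ => h i).trans ?_
  simp

theorem abs_mul_le {a b A B : ℝ} (h1 : |a| ≤ A) (h2 : |b| ≤ B) : |a * b| ≤ A * B := by
  rw [abs_mul]
  exact mul_le_mul h1 h2 (abs_nonneg _) ((abs_nonneg _).trans h1)

def R1 (a : Fin n → Fin n → EuclideanSpace ℝ (Fin n) → ℝ) (u : EuclideanSpace ℝ (Fin n) → ℝ)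
    (x : EuclideanSpace ℝ (Fin n)) : ℝ :=
  -4 * (∑ i, (∑ j, a i j x * pd j u x) * (∑ k, pd i (gam a k) x * pd k u x))
  + 2 * ((∑ i, pd i (gam a i) x) * (∑ j, ∑ k, a j k x * (pd j u x * pd k u x)))
  + 2 * (∑ i, gam a i x * (∑ j, ∑ k, pd i (a j k) x * (pd j u x * pd k u x)))
def R2 (α : ℝ) (a : Fin n → Fin n → EuclideanSpace ℝ (Fin n) → ℝ) (u : EuclideanSpace ℝ (Fin n) → ℝ)
    (x : EuclideanSpace ℝ (Fin n)) : ℝ :=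
  8 * (∑ i, (∑ j, a i j x * pd j u x) * (pd i (cf a) x - 2 * α * (x i * cf a x)))
def R3 (a : Fin n → Fin n → EuclideanSpace ℝ (Fin n) → ℝ)
    (x : EuclideanSpace ℝ (Fin n)) : ℝ :=
  -8 * (cf a x * (∑ i, pd i (gam a i) x) + ∑ i, gam a i x * pd i (cf a) x)

theorem Rf_eq {a : Fin n → Fin n → EuclideanSpace ℝ (Fin n) → ℝ}
    (ha : ∀ i j, ContDiff ℝ 1 (a i j)) (hs : ∀ i j x, a i j x = a j i x)
    (u : EuclideanSpace ℝ (Fin n) → ℝ) (t α : ℝ) (x) :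
    Rf a (bet α a) (gfun α a) (bfun α a) u t x =
      phi α x * (8 * α ^ 2 * (∑ k, gam a k x * pd k u x) ^ 2
        + 4 * α ^ 2 * cf a x * (∑ j, ∑ k, a j k x * (pd j u x * pd k u x))
        + α * R1 a u x + α ^ 2 * (u x * R2 α a u x))
      + t * phi α x ^ 3 * (16 * α ^ 4 * cf a x ^ 2 + α ^ 3 * R3 a x) * u x ^ 2 := by
  have dphi : Differentiable ℝ (phi (n := n) α) := (contDiff_phi (m := 1) α).differentiable (by norm_num)
  have dgam : ∀ k, Differentiable ℝ (gam a k) := fun k => (contDiff_gam ha k).differentiable (by norm_num)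
  have dcf : Differentiable ℝ (cf a) := (contDiff_cf ha).differentiable (by norm_num)
  have pbet : ∀ i k, pd i (bet α a k) x =
      -2 * α * phi α x * pd i (gam a k) x + 4 * α ^ 2 * phi α x * (x i * gam a k x) := by
    intro i k
    unfold bet
    rw [pd_const_mul i _ (by fun_prop), pd_mul i (by fun_prop) (by fun_prop), pd_phi]
    ring
  have pg : ∀ i, pd i (gfun α a) x =
      8 * α ^ 2 * phi α x * (pd i (cf a) x - 2 * α * (x i * cf a x)) := by
    intro i
    unfold gfun
    rw [pd_const_mul i _ (by fun_prop), pd_mul i (by fun_prop) (by fun_prop), pd_phi]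
    ring
  have pb : ∀ i, pd i (bfun α a) x =
      4 * α ^ 2 * phi α x ^ 2 * (pd i (cf a) x - 4 * α * (x i * cf a x)) := by
    intro i
    unfold bfun
    rw [pd_const_mul i _ (by fun_prop), pd_mul (f := fun y => phi α y * phi α y) i (by fun_prop) (by fun_prop),
      pd_mul i (by fun_prop) (by fun_prop), pd_phi]
    ring
  have pbb : ∀ i, pd i (fun y => bfun α a y * bet α a i y) x =
      48 * α ^ 4 * phi α x ^ 3 * cf a x * (gam a i x * x i)
       - 8 * α ^ 3 * phi α x ^ 3 * (gam a i x * pd i (cf a) x)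
       - 8 * α ^ 3 * phi α x ^ 3 * cf a x * pd i (gam a i) x := by
    intro i
    rw [pd_mul i ((contDiff_bfun ha α).differentiable (by norm_num) x)
      ((contDiff_bet ha α i).differentiable (by norm_num) x), pb, pbet]
    unfold bfun bet
    ring
  have hsym : ∑ i, (∑ j, a i j x * pd j u x) * x i = ∑ k, gam a k x * pd k u x := by
    unfold gam
    simp only [Finset.sum_mul]
    rw [Finset.sum_comm]
    refine Finset.sum_congr rfl fun i _ => Finset.sum_congr rfl fun j _ => ?_
    rw [hs j i x]; ring
  have e1 : ∑ i, (∑ j, a i j x * pd j u x) * (∑ k, pd i (bet α a k) x * pd k u x) =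
      -2 * α * phi α x * (∑ i, (∑ j, a i j x * pd j u x) * (∑ k, pd i (gam a k) x * pd k u x))
      + 4 * α ^ 2 * phi α x * (∑ k, gam a k x * pd k u x) ^ 2 := by
    have : ∀ i, (∑ k, pd i (bet α a k) x * pd k u x) =
       -2 * α * phi α x * (∑ k, pd i (gam a k) x * pd k u x)
        + 4 * α ^ 2 * phi α x * (∑ k, gam a k x * pd k u x) * x i := by
      intro i
      have e : ∀ k, pd i (bet α a k) x * pd k u x =
        -2 * α * phi α x * (pd i (gam a k) x * pd k u x)
        + 4 * α ^ 2 * phi α x * (gam a k x * pd k u x) * x i := by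
        intro k; rw [pbet]; ring
      simp only [e, Finset.sum_add_distrib, ← Finset.mul_sum, ← Finset.sum_mul]
    have e : ∀ i, (∑ j, a i j x * pd j u x) * (∑ k, pd i (bet α a k) x * pd k u x) =
      -2 * α * phi α x * ((∑ j, a i j x * pd j u x) * (∑ k, pd i (gam a k) x * pd k u x))
      + 4 * α ^ 2 * phi α x * (∑ k, gam a k x * pd k u x) * ((∑ j, a i j x * pd j u x) * x i) := by
      intro i; rw [this]; ring
    rw [Finset.sum_congr rfl fun i _ => e i, Finset.sum_add_distrib, ← Finset.mul_sum,
      ← Finset.mul_sum, hsym]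
    ring
  have e2 : ∑ i, pd i (bet α a i) x =
      -2 * α * phi α x * (∑ i, pd i (gam a i) x) + 4 * α ^ 2 * phi α x * cf a x := by
    simp only [pbet, Finset.sum_add_distrib, ← Finset.mul_sum, cf]
    congr 2
    exact Finset.sum_congr rfl fun i _ => mul_comm _ _
  have e3 : ∑ i, bet α a i x * (∑ j, ∑ k, pd i (a j k) x * (pd j u x * pd k u x)) =
      -2 * α * phi α x * ∑ i, gam a i x * (∑ j, ∑ k, pd i (a j k) x * (pd j u x * pd k u x)) := by
    rw [Finset.mul_sum]
    refine Finset.sum_congr rfl fun i _ => ?_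
    unfold bet; ring
  have e4 : ∑ i, (∑ j, a i j x * pd j u x) * pd i (gfun α a) x =
      α ^ 2 * phi α x * R2 α a u x := by
    unfold R2
    rw [Finset.mul_sum, Finset.mul_sum]
    refine Finset.sum_congr rfl fun i _ => ?_
    rw [pg]; ring
  have e5 : ∑ i, pd i (fun y => bfun α a y * bet α a i y) x =
      48 * α ^ 4 * phi α x ^ 3 * cf a x ^ 2 + α ^ 3 * phi α x ^ 3 * R3 a x := by
    simp only [pbb, Finset.sum_sub_distrib, ← Finset.mul_sum]
    rw [show ∑ i, gam a i x * x i = cf a x from rfl]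
    unfold R3; ring
  unfold Rf
  rw [e1, e2, e3, e4, e5]
  unfold R1 gfun bfun
  ring

theorem R_bounds {a : Fin n → Fin n → EuclideanSpace ℝ (Fin n) → ℝ}
    (ha : ∀ i j, ContDiff ℝ 1 (a i j)) {M : ℝ} {x : EuclideanSpace ℝ (Fin n)}
    (hx : ∀ i, |x i| ≤ 3) (hM : ∀ i j, |a i j x| ≤ M) (hM' : ∀ k i j, |pd k (a i j) x| ≤ M) (hM0 : 0 ≤ M) :
    (∀ k, |gam a k x| ≤ 15 * (n + 1) ^ 2 * (M + 1)) ∧ (∀ i k, |pd i (gam a k) x| ≤ 15 * (n + 1) ^ 2 * (M + 1)) ∧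
    (|cf a x| ≤ 15 * (n + 1) ^ 2 * (M + 1)) ∧ (∀ i, |pd i (cf a) x| ≤ 15 * (n + 1) ^ 2 * (M + 1)) := by
  have da : ∀ i j, Differentiable ℝ (a i j) := fun i j => (ha i j).differentiable (by norm_num)
  have dgam : ∀ k, Differentiable ℝ (gam a k) := fun k => (contDiff_gam ha k).differentiable (by norm_num)
  have hn0 : (0:ℝ) ≤ n := Nat.cast_nonneg n
  have hδ : ∀ i j, |pd i (fun y : EuclideanSpace ℝ (Fin n) => y j) x| ≤ 1 := by
    intro i j; rw [pd_coord]; split_ifs <;> simp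
  have g1 : ∀ k, |gam a k x| ≤ n * (M * 3) := fun k => abs_sum_le_card fun j => abs_mul_le (hM k j) (hx j)
  have g2 : ∀ i k, |pd i (gam a k) x| ≤ n * (M * 3 + M * 1) := by
    intro i k
    unfold gam
    rw [pd_sum i (fun j _ => by fun_prop)]
    refine abs_sum_le_card fun j => ?_
    rw [pd_mul i (by fun_prop) (by fun_prop)]
    exact (abs_add_le _ _).trans (add_le_add (abs_mul_le (hM' i k j) (hx j)) (abs_mul_le (hM k j) (hδ i j)))
  have c1 : |cf a x| ≤ n * (n * (M * 3) * 3) := abs_sum_le_card fun j => abs_mul_le (g1 j) (hx j)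
  have c2 : ∀ i, |pd i (cf a) x| ≤ n * (n * (M * 3 + M * 1) * 3 + n * (M * 3) * 1) := by
    intro i
    unfold cf
    rw [pd_sum i (fun j _ => by fun_prop)]
    refine abs_sum_le_card fun j => ?_
    rw [pd_mul i (by fun_prop) (by fun_prop)]
    exact (abs_add_le _ _).trans (add_le_add (abs_mul_le (g2 i j) (hx j)) (abs_mul_le (g1 j) (hδ i j)))
  have hnM : 0 ≤ (n:ℝ) * M := by positivity
  have hn2M : 0 ≤ (n:ℝ) ^ 2 * M := by positivity
  have hn2 : 0 ≤ (n:ℝ) ^ 2 := by positivity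
  refine ⟨fun k => (g1 k).trans ?_, fun i k => (g2 i k).trans ?_, c1.trans ?_, fun i => (c2 i).trans ?_⟩ <;> nlinarith

theorem R123_bounds {a : Fin n → Fin n → EuclideanSpace ℝ (Fin n) → ℝ} {u : EuclideanSpace ℝ (Fin n) → ℝ}
    {K P α : ℝ} {x : EuclideanSpace ℝ (Fin n)} (hα : 0 ≤ α)
    (hx : ∀ i, |x i| ≤ K) (hM : ∀ i j, |a i j x| ≤ K) (hM' : ∀ k i j, |pd k (a i j) x| ≤ K)
    (hg : ∀ k, |gam a k x| ≤ K) (hg' : ∀ i k, |pd i (gam a k) x| ≤ K)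
    (hc : |cf a x| ≤ K) (hc' : ∀ i, |pd i (cf a) x| ≤ K) (hp : ∀ i, |pd i u x| ≤ P) :
    |R1 a u x| ≤ 8 * n ^ 3 * K ^ 2 * P ^ 2 ∧
    |R2 α a u x| ≤ (8 * n ^ 2 * K * (K + 2 * α * K ^ 2)) * P ∧ |R3 a x| ≤ 16 * n * K ^ 2 := by
  have q : ∀ i, |∑ j, a i j x * pd j u x| ≤ n * (K * P) := fun i =>
    abs_sum_le_card fun j => abs_mul_le (hM i j) (hp j)
  have s1 : |(∑ i, (∑ j, a i j x * pd j u x) * (∑ k, pd i (gam a k) x * pd k u x))|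
      ≤ n * ((n * (K * P)) * (n * (K * P))) := by
    refine abs_sum_le_card fun i => abs_mul_le (q i) ?_
    exact abs_sum_le_card fun j => abs_mul_le (hg' i j) (hp j)
  have s2 : |(∑ i, pd i (gam a i) x) * (∑ j, ∑ k, a j k x * (pd j u x * pd k u x))|
      ≤ (n * K) * (n * (n * (K * (P * P)))) := by
    refine abs_mul_le (abs_sum_le_card fun i => hg' i i) ?_
    refine abs_sum_le_card fun j => abs_sum_le_card fun k => ?_
    exact abs_mul_le (hM j k) (abs_mul_le (hp j) (hp k))
  have s3 : |(∑ i, gam a i x * (∑ j, ∑ k, pd i (a j k) x * (pd j u x * pd k u x)))|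
      ≤ n * (K * (n * (n * (K * (P * P))))) := by
    refine abs_sum_le_card fun i => abs_mul_le (hg i) ?_
    refine abs_sum_le_card fun j => abs_sum_le_card fun k => ?_
    exact abs_mul_le (hM' i j k) (abs_mul_le (hp j) (hp k))
  have s4 : |(∑ i, (∑ j, a i j x * pd j u x) * (pd i (cf a) x - 2 * α * (x i * cf a x)))|
      ≤ n * ((n * (K * P)) * (K + (2 * α) * (K * K))) := by
    refine abs_sum_le_card fun i => abs_mul_le (q i) ?_
    refine (abs_sub _ _).trans (add_le_add (hc' i) ?_)
    exact abs_mul_le (by rw [abs_of_nonneg]; positivity) (abs_mul_le (hx i) hc)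
  have s5 : |(cf a x * (∑ i, pd i (gam a i) x) + ∑ i, gam a i x * pd i (cf a) x)| ≤
      K * (n * K) + n * (K * K) := by
    refine (abs_add_le _ _).trans (add_le_add (abs_mul_le hc (abs_sum_le_card fun i => hg' i i)) ?_)
    exact abs_sum_le_card fun i => abs_mul_le (hg i) (hc' i)
  refine ⟨?_, ?_, ?_⟩
  · unfold R1
    rw [abs_le] at *
    constructor <;> nlinarith
  · unfold R2
    rw [abs_le] at *
    constructor <;> nlinarith
  · unfold R3
    rw [abs_le] at *
    constructor <;> nlinarith

theorem norm_sq_sum (x : EuclideanSpace ℝ (Fin n)) : ∑ j, x j * x j = ‖x‖ ^ 2 := by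
  rw [EuclideanSpace.norm_sq_eq]
  exact Finset.sum_congr rfl fun i _ => by simp [sq]

theorem coord_le_norm (x : EuclideanSpace ℝ (Fin n)) (i) : |x i| ≤ ‖x‖ := by
  have := PiLp.norm_apply_le x i
  simpa using this

theorem scalar_core {lam C1 C2 C3 α e m t P U G c Ap r1 r2 r3 ph D : ℝ} (hlam : 0 < lam)
    (hC1' : 0 ≤ C1) (hC3' : 0 ≤ C3) (hα1 : 1 ≤ α) (hαl : 2 * C1 + 2 * C3 ≤ α * lam ^ 2)
    (he : e = m * (lam ^ 2 / 2)) (he0 : 0 < e) (hD : D = α ^ 2 * C2) (hD0 : 0 ≤ D)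
    (ht : t ≥ D ^ 2 / e ^ 2 + 1) (hP0 : 0 ≤ P) (hr1 : |r1| ≤ C1 * P ^ 2) (hr2 : |r2| ≤ C2 * P)
    (hr3 : |r3| ≤ C3) (hellp : lam * P ^ 2 ≤ Ap) (hc : lam / 4 ≤ c) (hph1 : ph ≤ 1) (hph0 : 0 < ph)
    (hph3 : m ≤ ph ^ 3) (hphm1 : m ≤ ph) (ht0 : 0 < t) :
    e / 2 * (P ^ 2 + t * U ^ 2) ≤
      ph * (8 * α ^ 2 * G ^ 2 + 4 * α ^ 2 * c * Ap + α * r1 + α ^ 2 * (U * r2))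
      + t * ph ^ 3 * (16 * α ^ 4 * c ^ 2 + α ^ 3 * r3) * U ^ 2 := by
  have t1 : lam ^ 2 / 2 * P ^ 2 - D * (|U| * P) ≤ 8 * α ^ 2 * G ^ 2
        + 4 * α ^ 2 * c * Ap
        + α * r1 + α ^ 2 * (U * r2) := by
    have h1 : lam / 4 * (lam * P ^ 2) ≤ c * Ap :=
      mul_le_mul hc hellp (by positivity) ((by positivity : 0 ≤ lam / 4).trans hc)
    have h2 : -(C1 * P ^ 2) ≤ r1 := (abs_le.1 hr1).1
    have h3 : -(|U| * (C2 * P)) ≤ U * r2 := by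
      have := abs_mul_le (le_refl |U|) hr2
      exact (abs_le.1 this).1
    have h4 : 0 ≤ 8 * α ^ 2 * G ^ 2 := by positivity
    have h5 : 4 * α ^ 2 * (lam / 4 * (lam * P ^ 2)) ≤ 4 * α ^ 2 * c * Ap := by
      rw [mul_assoc (4 * α ^ 2)]; gcongr
    have h6 : α * -(C1 * P ^ 2) ≤ α * r1 := by gcongr
    have h7 : α ^ 2 * -(|U| * (C2 * P)) ≤ α ^ 2 * (U * r2) := by gcongr
    have h8 : α * (2 * C1) * P ^ 2 ≤ α * (α * lam ^ 2) * P ^ 2 := by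
      have : 2 * C1 ≤ α * lam ^ 2 := by linarith
      gcongr
    have h9 : 1 * (lam ^ 2 * P ^ 2) ≤ α ^ 2 * (lam ^ 2 * P ^ 2) := by
      gcongr; nlinarith
    rw [hD]
    linarith
  have t2 : lam ^ 2 / 2 ≤ 16 * α ^ 4 * c ^ 2 + α ^ 3 * r3 := by
    have h1 : (lam / 4) ^ 2 ≤ c ^ 2 := by gcongr
    have h2 : -C3 ≤ r3 := (abs_le.1 hr3).1
    have h3 : 16 * α ^ 4 * (lam / 4) ^ 2 ≤ 16 * α ^ 4 * c ^ 2 := by gcongr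
    have h4 : α ^ 3 * -C3 ≤ α ^ 3 * r3 := by gcongr
    have h5 : α ^ 3 * (2 * C3) ≤ α ^ 3 * (α * lam ^ 2) := by
      have : 2 * C3 ≤ α * lam ^ 2 := by linarith
      gcongr
    have h6 : 1 * lam ^ 2 ≤ α ^ 4 * lam ^ 2 := by
      gcongr; exact one_le_pow₀ hα1
    nlinarith
  set X := 8 * α ^ 2 * G ^ 2
        + 4 * α ^ 2 * c * Ap
        + α * r1 + α ^ 2 * (U * r2)
  set Y := 16 * α ^ 4 * c ^ 2 + α ^ 3 * r3
  have u1 : e * P ^ 2 - D * (|U| * P) ≤ ph * X := by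
    have h1 : ph * (lam ^ 2 / 2 * P ^ 2 - D * (|U| * P)) ≤ ph * X := by gcongr
    have h2 : m * (lam ^ 2 / 2 * P ^ 2) ≤ ph * (lam ^ 2 / 2 * P ^ 2) := by gcongr
    have h3 : ph * (D * (|U| * P)) ≤ 1 * (D * (|U| * P)) := by gcongr
    rw [he]; linarith
  have u2 : t * e * U ^ 2 ≤ t * ph ^ 3 * Y * U ^ 2 := by
    have : e ≤ ph ^ 3 * Y := by
      rw [he]; gcongr
    rw [mul_assoc t (ph ^ 3)]
    gcongr
  have u3 : D * (|U| * P) ≤ e / 2 * P ^ 2 + t * e / 2 * U ^ 2 := by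
    have h1 : D ^ 2 / e ^ 2 ≤ t := by linarith
    have h2 : D ^ 2 / e ≤ t * e := by
      have h := mul_le_mul_of_nonneg_right h1 he0.le
      have h' : D ^ 2 / e ^ 2 * e = D ^ 2 / e := by field_simp
      linarith
    have h3 : D * (|U| * P) ≤ e / 2 * P ^ 2 + (D ^ 2 / e) / 2 * |U| ^ 2 := by
      have : 0 ≤ (e * P - D * |U|) ^ 2 / (2 * e) := by positivity
      have h : (e * P - D * |U|) ^ 2 / (2 * e) = e / 2 * P ^ 2 + (D ^ 2 / e) / 2 * |U| ^ 2 - D * (|U| * P) := by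
        field_simp; ring
      linarith
    rw [sq_abs] at h3
    have h4 : (D ^ 2 / e) / 2 * U ^ 2 ≤ t * e / 2 * U ^ 2 := by gcongr
    linarith
  linarith

theorem R_lower (n : ℕ) {lam M : ℝ} (hlam : 0 < lam) (hM0 : 0 ≤ M) :
    ∃ α > 0, ∃ c1 > 0, ∃ t0 > 0, ∀ (a : Fin n → Fin n → EuclideanSpace ℝ (Fin n) → ℝ)
    (_ : ∀ i j, ContDiff ℝ 1 (a i j)) (_ : ∀ i j x, a i j x = a j i x)
    (u : EuclideanSpace ℝ (Fin n) → ℝ) (x : EuclideanSpace ℝ (Fin n)),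
    1 / 2 ≤ ‖x‖ → ‖x‖ ≤ 3 → (∀ i j, |a i j x| ≤ M) → (∀ k i j, |pd k (a i j) x| ≤ M) →
    (∀ ξ : Fin n → ℝ, lam * ∑ i, ξ i ^ 2 ≤ ∑ i, ∑ j, a i j x * (ξ i * ξ j)) →
    ∀ t ≥ t0, c1 * (∑ i, pd i u x ^ 2 + t * u x ^ 2) ≤
      Rf a (bet α a) (gfun α a) (bfun α a) u t x := by
  set K : ℝ := 15 * (n + 1) ^ 2 * (M + 1) with hK
  have hK3 : 3 ≤ K := by
    have : (0:ℝ) ≤ n := Nat.cast_nonneg n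
    have h1 : (1:ℝ) ≤ (n+1)^2 := by nlinarith
    nlinarith
  have hKM : M ≤ K := by
    have : (0:ℝ) ≤ n := Nat.cast_nonneg n
    have h1 : (1:ℝ) ≤ (n+1)^2 := by nlinarith
    nlinarith
  set C1 : ℝ := 8 * n ^ 3 * K ^ 2 with hC1
  set C3 : ℝ := 16 * n * K ^ 2 with hC3
  have hC1' : 0 ≤ C1 := by positivity
  have hC3' : 0 ≤ C3 := by positivity
  set α : ℝ := 1 + (2 * C1 + 2 * C3) / lam ^ 2 with hα
  have hα1 : 1 ≤ α := by rw [hα]; linarith [show 0 ≤ (2 * C1 + 2 * C3) / lam ^ 2 by positivity]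
  have hαl : 2 * C1 + 2 * C3 ≤ α * lam ^ 2 := by
    have : α * lam ^ 2 = lam ^ 2 + (2 * C1 + 2 * C3) := by rw [hα]; field_simp
    nlinarith [sq_nonneg lam]
  set C2 : ℝ := 8 * n ^ 2 * K * (K + 2 * α * K ^ 2) with hC2
  have hC2' : 0 ≤ C2 := by positivity
  set m : ℝ := Real.exp (-α * 9) ^ 3 with hm
  have hm0 : 0 < m := by positivity
  set e : ℝ := m * (lam ^ 2 / 2) with he
  have he0 : 0 < e := by positivity
  set D : ℝ := α ^ 2 * C2 with hD
  have hD0 : 0 ≤ D := by positivity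
  refine ⟨α, by linarith, e / 2, by positivity, D ^ 2 / e ^ 2 + 1, by positivity, ?_⟩
  clear_value K C1 C3 α C2 m e D
  intro a ha hs u x hx1 hx2 hM hM' hell t ht
  rw [Rf_eq ha hs]
  set P : ℝ := Real.sqrt (∑ i, pd i u x ^ 2) with hP
  have hP0 : 0 ≤ P := Real.sqrt_nonneg _
  have hP2 : ∑ i, pd i u x ^ 2 = P ^ 2 := by
    rw [hP, Real.sq_sqrt]; exact Finset.sum_nonneg fun i _ => sq_nonneg _
  have hp : ∀ i, |pd i u x| ≤ P := by
    intro i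
    refine Real.abs_le_sqrt ?_
    exact Finset.single_le_sum (f := fun i => pd i u x ^ 2) (fun i _ => sq_nonneg _) (Finset.mem_univ i)
  have hx : ∀ i, |x i| ≤ 3 := fun i => (coord_le_norm x i).trans hx2
  obtain ⟨b1, b2, b3, b4⟩ := R_bounds ha hx hM hM' hM0
  obtain ⟨r1, r2, r3⟩ := R123_bounds (α := α) (K := K) (P := P) (by linarith) (fun i => (hx i).trans hK3)
    (fun i j => (hM i j).trans hKM) (fun k i j => (hM' k i j).trans hKM) (hK ▸ b1) (hK ▸ b2) (hK ▸ b3) (hK ▸ b4) hp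
  rw [← hC1] at r1
  rw [← hC2] at r2
  rw [← hC3] at r3
  have hellp := hell (fun i => pd i u x)
  rw [hP2] at hellp
  set Ap := ∑ j, ∑ k, a j k x * (pd j u x * pd k u x) with hAp
  have hc : lam / 4 ≤ cf a x := by
    have h := hell (fun i => x i)
    have h1 : ∑ i, x i ^ 2 = ‖x‖ ^ 2 := by rw [← norm_sq_sum]; exact Finset.sum_congr rfl fun i _ => sq _
    rw [h1] at h
    have h2 : cf a x = ∑ i, ∑ j, a i j x * (x i * x j) := by
      unfold cf gam
      refine Finset.sum_congr rfl fun i _ => ?_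
      rw [Finset.sum_mul]
      refine Finset.sum_congr rfl fun j _ => ?_
      ring
    rw [h2]
    have h3 : (1 / 2 : ℝ) ^ 2 ≤ ‖x‖ ^ 2 := by gcongr
    have h4 := mul_le_mul_of_nonneg_left h3 hlam.le
    linarith
  set ph := phi α x with hph
  have hph1 : ph ≤ 1 := by
    rw [hph]; unfold phi
    rw [norm_sq_sum]
    apply Real.exp_le_one_iff.2
    have := mul_nonneg (zero_le_one.trans hα1) (sq_nonneg ‖x‖)
    linarith
  have hphm : Real.exp (-α * 9) ≤ ph := by
    rw [hph]; unfold phi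
    rw [norm_sq_sum]
    apply Real.exp_le_exp.2
    have h1 : ‖x‖ ^ 2 ≤ 3 ^ 2 := by gcongr
    have := mul_le_mul_of_nonneg_left h1 (zero_le_one.trans hα1)
    linarith
  have hph0 : 0 < ph := (Real.exp_pos _).trans_le hphm
  have hph3 : m ≤ ph ^ 3 := by
    rw [hm]; exact pow_le_pow_left₀ (Real.exp_pos _).le hphm 3
  have hphm1 : m ≤ ph := hph3.trans (pow_le_of_le_one hph0.le hph1 (by norm_num))
  have ht0 : 0 < t := lt_of_lt_of_le (by positivity) ht
  rw [hP2]
  exact scalar_core hlam hC1' hC3' hα1 hαl he he0 hD hD0 ht hP0 r1 r2 r3 hellp hc hph1 hph0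
    hph3 hphm1 ht0


theorem Lop_eq_sum {a : Fin n → Fin n → EuclideanSpace ℝ (Fin n) → ℝ}
    (ha : ∀ i j, ContDiff ℝ 1 (a i j)) {u : EuclideanSpace ℝ (Fin n) → ℝ}
    (hu : ContDiff ℝ 2 u) (x) :
    Lop a u x = ∑ i, pd i (fun y => ∑ j, a i j y * pd j u y) x := by
  unfold Lop
  have da : ∀ i j, Differentiable ℝ (a i j) := fun i j => (ha i j).differentiable (by norm_num)
  have dp : ∀ j, Differentiable ℝ (pd j u) :=
    fun j => (contDiff_pd1 j hu).differentiable (by norm_num)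
  refine Finset.sum_congr rfl fun i _ => ?_
  rw [pd_sum i (fun j _ => by fun_prop)]

theorem continuous_Lop {a : Fin n → Fin n → EuclideanSpace ℝ (Fin n) → ℝ}
    (ha : ∀ i j, ContDiff ℝ 1 (a i j)) {u : EuclideanSpace ℝ (Fin n) → ℝ}
    (hu : ContDiff ℝ 2 u) : Continuous (Lop a u) := by
  unfold Lop
  refine continuous_finsetSum _ fun i _ => continuous_finsetSum _ fun j _ => ?_
  refine continuous_pd i ?_
  have := contDiff_pd1 j hu
  have := ha i j
  fun_prop

theorem pd_zero_of_notMem {u : EuclideanSpace ℝ (Fin n) → ℝ} {x} (hx : x ∉ tsupport u) (i) :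
    pd i u x = 0 := by
  unfold pd
  rw [fderiv_of_notMem_tsupport ℝ hx]; simp

theorem tsupport_pd_subset (u : EuclideanSpace ℝ (Fin n) → ℝ) (i) :
    tsupport (pd i u) ⊆ tsupport u := by
  refine closure_minimal ?_ (isClosed_tsupport u)
  intro x hx
  by_contra h
  exact hx (pd_zero_of_notMem h i)

theorem Lop_zero_of_notMem {a : Fin n → Fin n → EuclideanSpace ℝ (Fin n) → ℝ}
    {u : EuclideanSpace ℝ (Fin n) → ℝ} {x} (hx : x ∉ tsupport u) : Lop a u x = 0 := by
  unfold Lop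
  refine Finset.sum_eq_zero fun i _ => Finset.sum_eq_zero fun j _ => ?_
  refine pd_zero_of_notMem (fun h => hx ?_) i
  exact tsupport_pd_subset u j ((tsupport_mul_subset_right (f := a i j) (g := pd j u)) h)

theorem sum_gradphi {a : Fin n → Fin n → EuclideanSpace ℝ (Fin n) → ℝ} (α : ℝ) (i) (x) :
    ∑ j, a i j x * pd j (phi α) x = bet α a i x := by
  unfold bet gam
  rw [Finset.mul_sum, Finset.mul_sum]
  refine Finset.sum_congr rfl fun j _ => ?_
  rw [pd_phi]; ring

theorem sum_bet_phi {a : Fin n → Fin n → EuclideanSpace ℝ (Fin n) → ℝ} (α : ℝ) (x) :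
    ∑ i, bet α a i x * pd i (phi α) x = bfun α a x := by
  unfold bfun cf
  rw [Finset.mul_sum, Finset.mul_sum]
  refine Finset.sum_congr rfl fun j _ => ?_
  rw [pd_phi]; unfold bet; ring

theorem pd_exp_phi (τ α : ℝ) (i : Fin n) (x) : pd i (fun y => Real.exp (τ * phi α y)) x =
    τ * (Real.exp (τ * phi α x) * pd i (phi α) x) := by
  have dphi : Differentiable ℝ (phi (n := n) α) := (contDiff_phi (m := 1) α).differentiable (by norm_num)
  rw [pd_exp i (by fun_prop), pd_const_mul i _ (by fun_prop)]; ring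

theorem contDiff_exp_phi (τ α : ℝ) {m : WithTop ℕ∞} :
    ContDiff ℝ m (fun y : EuclideanSpace ℝ (Fin n) => Real.exp (τ * phi α y)) := by
  have := contDiff_phi (n := n) α (m := m)
  fun_prop

theorem Lop_exp {a : Fin n → Fin n → EuclideanSpace ℝ (Fin n) → ℝ}
    (ha : ∀ i j, ContDiff ℝ 1 (a i j)) (τ α : ℝ) (x) :
    Lop a (fun y => Real.exp (τ * phi α y)) x =
      Real.exp (τ * phi α x) * (τ ^ 2 * bfun α a x + τ * ∑ i, pd i (bet α a i) x) := by
  have dh : Differentiable ℝ (fun y : EuclideanSpace ℝ (Fin n) => Real.exp (τ * phi α y)) :=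
    (contDiff_exp_phi (m := 1) τ α).differentiable (by norm_num)
  have db : ∀ i, Differentiable ℝ (bet α a i) := fun i => (contDiff_bet ha α i).differentiable (by norm_num)
  rw [Lop_eq_sum ha (contDiff_exp_phi τ α)]
  have e : ∀ i, (fun y => ∑ j, a i j y * pd j (fun y => Real.exp (τ * phi α y)) y) =
      fun y => τ * (Real.exp (τ * phi α y) * bet α a i y) := by
    intro i; ext y
    rw [← sum_gradphi, Finset.mul_sum, Finset.mul_sum]
    refine Finset.sum_congr rfl fun j _ => ?_
    rw [pd_exp_phi]; ring
  have e' : ∀ i, pd i (fun y => ∑ j, a i j y * pd j (fun y => Real.exp (τ * phi α y)) y) x =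
      Real.exp (τ * phi α x) * τ ^ 2 * (bet α a i x * pd i (phi α) x)
        + Real.exp (τ * phi α x) * τ * pd i (bet α a i) x := by
    intro i
    rw [e, pd_const_mul i _ ((dh x).fun_mul (db i x)),
      pd_mul (f := fun y => Real.exp (τ * phi α y)) i (dh x) (by fun_prop), pd_exp_phi]
    ring
  simp only [e', Finset.sum_add_distrib, ← Finset.mul_sum, sum_bet_phi]
  ring

theorem conj_identity {a : Fin n → Fin n → EuclideanSpace ℝ (Fin n) → ℝ}
    (ha : ∀ i j, ContDiff ℝ 1 (a i j)) (hs : ∀ i j x, a i j x = a j i x)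
    {v : EuclideanSpace ℝ (Fin n) → ℝ} (hv : ContDiff ℝ 2 v) (τ α : ℝ) (g : EuclideanSpace ℝ (Fin n) → ℝ) (x) :
    Lop a (fun y => Real.exp (τ * phi α y) * v y) x
      + τ ^ 2 * bfun α a x * (Real.exp (τ * phi α x) * v x)
      - τ * Qf (bet α a) g (fun y => Real.exp (τ * phi α y) * v y) x
    = Real.exp (τ * phi α x) * (Lop a v x + τ * ((∑ i, pd i (bet α a i) x) - g x) * v x) := by
  have dh : Differentiable ℝ (fun y : EuclideanSpace ℝ (Fin n) => Real.exp (τ * phi α y)) :=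
    (contDiff_exp_phi (m := 1) τ α).differentiable (by norm_num)
  have dv : Differentiable ℝ v := hv.differentiable (by norm_num)
  rw [Lop_mul ha (contDiff_exp_phi τ α) hv, Lop_exp ha]
  unfold Qf
  have e1 : ∑ i, ∑ j, a i j x * (pd i (fun y => Real.exp (τ * phi α y)) x * pd j v x
      + pd j (fun y => Real.exp (τ * phi α y)) x * pd i v x) =
      2 * τ * Real.exp (τ * phi α x) * ∑ i, bet α a i x * pd i v x := by
    have h1 : ∑ i, ∑ j, a i j x * (pd j (fun y => Real.exp (τ * phi α y)) x * pd i v x) =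
        τ * Real.exp (τ * phi α x) * ∑ i, bet α a i x * pd i v x := by
      rw [Finset.mul_sum]
      refine Finset.sum_congr rfl fun i _ => ?_
      rw [← sum_gradphi, Finset.sum_mul, Finset.mul_sum]
      refine Finset.sum_congr rfl fun j _ => ?_
      rw [pd_exp_phi]; ring
    have h2 : ∑ i, ∑ j, a i j x * (pd i (fun y => Real.exp (τ * phi α y)) x * pd j v x) =
        ∑ i, ∑ j, a i j x * (pd j (fun y => Real.exp (τ * phi α y)) x * pd i v x) := by
      rw [Finset.sum_comm]
      refine Finset.sum_congr rfl fun i _ => Finset.sum_congr rfl fun j _ => ?_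
      rw [hs j i]
    simp only [mul_add, Finset.sum_add_distrib]
    rw [h2, h1]; ring
  have e2 : ∑ k, bet α a k x * pd k (fun y => Real.exp (τ * phi α y) * v y) x =
      Real.exp (τ * phi α x) * (∑ i, bet α a i x * pd i v x)
        + τ * Real.exp (τ * phi α x) * v x * bfun α a x := by
    rw [← sum_bet_phi, Finset.mul_sum, Finset.mul_sum, ← Finset.sum_add_distrib]
    refine Finset.sum_congr rfl fun k _ => ?_
    rw [pd_mul k (dh x) (dv x), pd_exp_phi]; ring
  rw [e1, e2]
  ring

set_option maxHeartbeats 1600000 in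
theorem carleman (n : ℕ) {lam M : ℝ} (hlam : 0 < lam) (hM0 : 0 ≤ M) :
    ∃ α > 0, ∃ C > 0, ∃ τ0 ≥ 1, ∀ (a : Fin n → Fin n → EuclideanSpace ℝ (Fin n) → ℝ)
    (_ : ∀ i j, ContDiff ℝ 1 (a i j)) (_ : ∀ i j x, a i j x = a j i x)
    (v : EuclideanSpace ℝ (Fin n) → ℝ) (_ : ContDiff ℝ 2 v) (_ : HasCompactSupport v)
    (_ : ∀ x ∈ tsupport v, 1 / 2 ≤ ‖x‖ ∧ ‖x‖ ≤ 3 ∧ (∀ i j, |a i j x| ≤ M) ∧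
      (∀ k i j, |pd k (a i j) x| ≤ M) ∧
      (∀ ξ : Fin n → ℝ, lam * ∑ i, ξ i ^ 2 ≤ ∑ i, ∑ j, a i j x * (ξ i * ξ j))),
    ∀ τ ≥ τ0, τ * ∫ x, Real.exp (τ * phi α x) ^ 2 * (v x ^ 2 + ∑ i, pd i v x ^ 2) ≤
      C * ∫ x, Real.exp (τ * phi α x) ^ 2 * Lop a v x ^ 2 := by
  obtain ⟨α, hα, c1, hc1, t0, ht0, HR⟩ := R_lower n hlam hM0
  set K : ℝ := 15 * (n + 1) ^ 2 * (M + 1) with hK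
  have hK0 : 0 ≤ K := by positivity
  set G : ℝ := 4 * α ^ 2 * K + 2 * α * (n * K) with hG
  have hG0 : 0 ≤ G := by positivity
  refine ⟨α, hα, (3 + 72 * α ^ 2) / c1 * 2, by positivity, 1 + t0 + 2 * G ^ 2 / c1, ?_, ?_⟩
  · have : 0 ≤ 2 * G ^ 2 / c1 := by positivity
    linarith
  clear_value K G
  intro a ha hs v hv hvc hx τ hτ
  have hGc : 0 ≤ 2 * G ^ 2 / c1 := by positivity
  have hτ1 : 1 ≤ τ := by linarith
  have hτt : t0 ≤ τ ^ 2 := by nlinarith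
  have hτG : 2 * G ^ 2 ≤ τ * c1 := by
    have : 2 * G ^ 2 / c1 ≤ τ := by linarith
    rwa [div_le_iff₀ hc1] at this
  set u := fun y => Real.exp (τ * phi α y) * v y with hu_def
  have hu : ContDiff ℝ 2 u := (contDiff_exp_phi τ α).mul hv
  have htu : tsupport u ⊆ tsupport v := tsupport_mul_subset_right
  have huc : HasCompactSupport u := hvc.mul_left
  obtain ⟨hdi, hd0⟩ := integral_div_zero ha (contDiff_bet ha α) (contDiff_gfun ha α)
    (contDiff_bfun ha α) hu huc (τ ^ 2)
  set dv := fun x => ∑ i, pd i (Ff a (bet α a) (gfun α a) (bfun α a) u (τ ^ 2) i) x with hdv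
  have pt : ∀ x, τ * (Real.exp (τ * phi α x) ^ 2 * (v x ^ 2 + ∑ i, pd i v x ^ 2)) ≤
      (3 + 72 * α ^ 2) / c1 * 2 * (Real.exp (τ * phi α x) ^ 2 * Lop a v x ^ 2)
        + (3 + 72 * α ^ 2) / c1 * 2 * τ * dv x := by
    intro x
    have id1 := div_identity ha hs (contDiff_bet ha α) (contDiff_gfun ha α)
      (contDiff_bfun ha α) hu (τ ^ 2) x
    have id2 := conj_identity ha hs hv τ α (gfun α a) x
    rw [← hu_def] at id2
    rw [show (∑ i, pd i (Ff a (bet α a) (gfun α a) (bfun α a) u (τ ^ 2) i) x) = dv x from rfl] at id1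
    rw [show Real.exp (τ * phi α x) * v x = u x from rfl] at id2
    set h := Real.exp (τ * phi α x) with hh
    have hh0 : 0 < h := Real.exp_pos _
    set Q := Qf (bet α a) (gfun α a) u x
    set S := Lop a u x + τ ^ 2 * bfun α a x * u x
    set R := Rf a (bet α a) (gfun α a) (bfun α a) u (τ ^ 2) x with hR
    set L := Lop a v x with hL
    set d := (∑ i, pd i (bet α a i) x) - gfun α a x with hd
    have m1 : 2 * τ * R ≤ 2 * (h ^ 2 * L ^ 2) + 2 * τ ^ 2 * d ^ 2 * u x ^ 2 + 2 * τ * dv x := by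
      have h1 : (S - τ * Q) ^ 2 ≤ 2 * (h ^ 2 * L ^ 2) + 2 * τ ^ 2 * d ^ 2 * u x ^ 2 := by
        rw [id2, show u x = h * v x from rfl]
        have h3 := add_sq_le (a := h * L) (b := h * (τ * d * v x))
        have h4 : (h * (L + τ * d * v x)) ^ 2 = (h * L + h * (τ * d * v x)) ^ 2 := by ring
        have h5 : 2 * ((h * L) ^ 2 + (h * (τ * d * v x)) ^ 2) =
          2 * (h ^ 2 * L ^ 2) + 2 * τ ^ 2 * d ^ 2 * (h * v x) ^ 2 := by ring
        rw [h4, ← h5]; exact h3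
      have h2 : 2 * τ * (S * Q) = 2 * τ * (dv x - R) := by rw [id1]
      have h3 : 0 ≤ S ^ 2 + (τ * Q) ^ 2 := by positivity
      have h4 : (S - τ * Q) ^ 2 = S ^ 2 + (τ * Q) ^ 2 - 2 * τ * (S * Q) := by ring
      linarith
    by_cases hxs : x ∈ tsupport v
    · obtain ⟨hx1, hx2, hx3, hx4, hx5⟩ := hx x hxs
      have hRl := HR a ha hs u x hx1 hx2 hx3 hx4 hx5 (τ ^ 2) hτt
      rw [← hR] at hRl
      obtain ⟨b1, b2, b3, b4⟩ := R_bounds ha (fun i => (coord_le_norm x i).trans hx2) hx3 hx4 hM0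
      have hph1 : phi α x ≤ 1 := by
        unfold phi
        rw [norm_sq_sum]
        apply Real.exp_le_one_iff.2
        have := mul_nonneg hα.le (sq_nonneg ‖x‖)
        linarith
      have hph0 : 0 < phi α x := Real.exp_pos _
      have hdG : |d| ≤ G := by
        have hdv' : d = -(4 * α ^ 2) * (phi α x * cf a x) + (-(2 * α)) * (phi α x * ∑ i, pd i (gam a i) x) := by
          have dphi : Differentiable ℝ (phi (n := n) α) :=
            (contDiff_phi (m := 1) α).differentiable (by norm_num)
          have dgam : ∀ k, Differentiable ℝ (gam a k) :=
            fun k => (contDiff_gam ha k).differentiable (by norm_num)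
          have pbet : ∀ i, pd i (bet α a i) x =
              -2 * α * phi α x * pd i (gam a i) x + 4 * α ^ 2 * phi α x * (gam a i x * x i) := by
            intro i
            unfold bet
            rw [pd_const_mul i _ (by fun_prop), pd_mul i (by fun_prop) (by fun_prop), pd_phi]
            ring
          rw [hd]
          simp only [pbet, Finset.sum_add_distrib, ← Finset.mul_sum, gfun]
          rw [show ∑ i, gam a i x * x i = cf a x from rfl]
          ring
        rw [hdv', hG, hK]
        have hp1 : |phi α x| ≤ 1 := by rwa [abs_of_pos hph0]
        refine (abs_add_le _ _).trans (add_le_add ?_ ?_)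
        · refine abs_mul_le (by rw [abs_neg, abs_of_nonneg]; positivity) ?_
          have := abs_mul_le hp1 b3
          rwa [one_mul] at this
        · refine abs_mul_le (by rw [abs_neg, abs_of_nonneg]; positivity) ?_
          have := abs_mul_le hp1 (abs_sum_le_card fun i => b2 i i)
          rwa [one_mul] at this
      have hd2 : d ^ 2 ≤ G ^ 2 := sq_le_sq' (abs_le.1 hdG).1 (abs_le.1 hdG).2
      set V := u x ^ 2
      set Pu := ∑ i, pd i u x ^ 2
      have hV0 : 0 ≤ V := sq_nonneg _
      have hPu0 : 0 ≤ Pu := Finset.sum_nonneg fun i _ => sq_nonneg _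
      have m2 : τ * c1 * (Pu + τ ^ 2 * V) ≤ 2 * (h ^ 2 * L ^ 2) + 2 * τ * dv x := by
        have h1 : 2 * τ ^ 2 * d ^ 2 * V ≤ τ ^ 2 * (2 * G ^ 2) * V := by
          have : 2 * τ ^ 2 * d ^ 2 = τ ^ 2 * (2 * d ^ 2) := by ring
          rw [this]
          gcongr
        have h2 : τ ^ 2 * (2 * G ^ 2) * V ≤ τ ^ 2 * (τ * c1) * V := by gcongr
        have h3 : 2 * τ * (c1 * (Pu + τ ^ 2 * V)) ≤ 2 * τ * R := by gcongr
        have h4 : 0 ≤ τ * c1 * Pu := by positivity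
        linarith
      have dv1 : Differentiable ℝ v := hv.differentiable (by norm_num)
      have dh : Differentiable ℝ (fun y : EuclideanSpace ℝ (Fin n) => Real.exp (τ * phi α y)) :=
        (contDiff_exp_phi (m := 1) τ α).differentiable (by norm_num)
      have hpv : ∀ i, (h * pd i v x) ^ 2 ≤ 2 * pd i u x ^ 2 + 8 * τ ^ 2 * α ^ 2 * V * (x i * x i) := by
        intro i
        have e : h * pd i v x = pd i u x + 2 * τ * α * phi α x * u x * x i := by
          rw [hu_def, pd_mul i (dh x) (dv1 x), pd_exp_phi, pd_phi]
          rw [hh]; ring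
        rw [e]
        have h1 : (pd i u x + 2 * τ * α * phi α x * u x * x i) ^ 2 ≤
            2 * pd i u x ^ 2 + 8 * τ ^ 2 * α ^ 2 * (phi α x) ^ 2 * V * (x i * x i) := by
          have h3 := add_sq_le (a := pd i u x) (b := 2 * τ * α * phi α x * u x * x i)
          have h4 : (2 * τ * α * phi α x * u x * x i) ^ 2 =
            4 * τ ^ 2 * α ^ 2 * (phi α x) ^ 2 * V * (x i * x i) := by ring
          rw [h4] at h3
          linarith
        have h2 : 8 * τ ^ 2 * α ^ 2 * (phi α x) ^ 2 * V * (x i * x i) ≤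
            8 * τ ^ 2 * α ^ 2 * 1 * V * (x i * x i) := by
          have := mul_self_nonneg (x i)
          gcongr
          exact pow_le_one₀ hph0.le hph1
        linarith
      have m3 : h ^ 2 * (v x ^ 2 + ∑ i, pd i v x ^ 2) ≤ V + 2 * Pu + 72 * α ^ 2 * (τ ^ 2 * V) := by
        have h1 : h ^ 2 * ∑ i, pd i v x ^ 2 ≤ 2 * Pu + 8 * τ ^ 2 * α ^ 2 * V * ‖x‖ ^ 2 := by
          rw [← norm_sq_sum, Finset.mul_sum, Finset.mul_sum, Finset.mul_sum, ← Finset.sum_add_distrib]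
          refine Finset.sum_le_sum fun i _ => ?_
          rw [← mul_pow]; exact hpv i
        have h2 : 8 * τ ^ 2 * α ^ 2 * V * ‖x‖ ^ 2 ≤ 8 * τ ^ 2 * α ^ 2 * V * 3 ^ 2 := by gcongr
        have h3 : V = h ^ 2 * v x ^ 2 := by rw [← mul_pow]
        rw [mul_add, ← h3]
        linarith
      have m4 : V + 2 * Pu + 72 * α ^ 2 * (τ ^ 2 * V) ≤ (3 + 72 * α ^ 2) * (Pu + τ ^ 2 * V) := by
        have h1 : 1 * V ≤ τ ^ 2 * V := by gcongr; exact one_le_pow₀ hτ1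
        have h2 : 0 ≤ 72 * α ^ 2 * Pu := by positivity
        linarith
      have m5 := mul_le_mul_of_nonneg_left (m3.trans m4) (by linarith : 0 ≤ τ)
      have m6 := mul_le_mul_of_nonneg_left m2 (by positivity : 0 ≤ (3 + 72 * α ^ 2) / c1)
      have e6 : (3 + 72 * α ^ 2) / c1 * (τ * c1 * (Pu + τ ^ 2 * V)) =
        τ * ((3 + 72 * α ^ 2) * (Pu + τ ^ 2 * V)) := by field_simp
      rw [e6] at m6
      linarith
    · have hv0 : v x = 0 := image_eq_zero_of_notMem_tsupport hxs
      have hpv0 : ∀ i, pd i v x = 0 := fun i => pd_zero_of_notMem hxs i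
      have hu0 : u x = 0 := by simp [hu_def, hv0]
      have hpu0 : ∀ i, pd i u x = 0 := fun i => pd_zero_of_notMem (fun hh => hxs (htu hh)) i
      have hR0 : R = 0 := by
        rw [hR]; unfold Rf; simp [hu0, hpu0]
      rw [hR0, hu0] at m1
      have m6 := mul_le_mul_of_nonneg_left m1 (by positivity : 0 ≤ (3 + 72 * α ^ 2) / c1)
      simp only [hv0, hpv0]
      simp
      simp at m6
      linarith
  have hexp : Continuous (fun x : EuclideanSpace ℝ (Fin n) => Real.exp (τ * phi α x)) :=
    (contDiff_exp_phi (m := 1) τ α).continuous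
  have hcpd : ∀ i, Continuous (pd i v) := fun i => (contDiff_pd1 i hv).continuous
  have hcL := continuous_Lop ha hv
  have i1 : Integrable (fun x => Real.exp (τ * phi α x) ^ 2 * (v x ^ 2 + ∑ i, pd i v x ^ 2)) := by
    refine Continuous.integrable_of_hasCompactSupport ?_ ?_
    · have := hv.continuous
      fun_prop
    · refine hvc.mono' fun x hx' => ?_
      by_contra hxs
      apply hx'
      simp [image_eq_zero_of_notMem_tsupport hxs, pd_zero_of_notMem hxs]
  have i2 : Integrable (fun x => Real.exp (τ * phi α x) ^ 2 * Lop a v x ^ 2) := by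
    refine Continuous.integrable_of_hasCompactSupport ?_ ?_
    · fun_prop
    · refine hvc.mono' fun x hx' => ?_
      by_contra hxs
      apply hx'
      simp [Lop_zero_of_notMem hxs]
  have := integral_mono (i1.const_mul τ) ((i2.const_mul ((3 + 72 * α ^ 2) / c1 * 2)).add
    (hdi.const_mul ((3 + 72 * α ^ 2) / c1 * 2 * τ))) pt
  rw [integral_const_mul, integral_add' (i2.const_mul _) (hdi.const_mul _), integral_const_mul,
    integral_const_mul, hd0] at this
  linarith


theorem exists_cutoff (n : ℕ) : ∃ η : EuclideanSpace ℝ (Fin n) → ℝ, ContDiff ℝ 2 η ∧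
    HasCompactSupport η ∧ (∀ x ∈ tsupport η, 1 / 2 ≤ ‖x‖ ∧ ‖x‖ ≤ 14 / 5) ∧
    (∀ x, 1 ≤ ‖x‖ → ‖x‖ < 5 / 2 → η =ᶠ[nhds x] fun _ => 1) ∧
    ∃ B ≥ 0, (∀ x i, |pd i η x| ≤ B) ∧ (∀ x i j, |pd i (pd j η) x| ≤ B) := by
  let χ1 : ContDiffBump (0 : EuclideanSpace ℝ (Fin n)) := ⟨1 / 2, 3 / 4, by norm_num, by norm_num⟩
  let χ2 : ContDiffBump (0 : EuclideanSpace ℝ (Fin n)) := ⟨5 / 2, 14 / 5, by norm_num, by norm_num⟩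
  have h1 : ContDiff ℝ 2 χ1 := χ1.contDiff
  have h2 : ContDiff ℝ 2 χ2 := χ2.contDiff
  have hη : ContDiff ℝ 2 (fun x => (1 - χ1 x) * χ2 x) := by fun_prop
  have hc : HasCompactSupport (fun x => (1 - χ1 x) * χ2 x) := χ2.hasCompactSupport.mul_left
  refine ⟨fun x => (1 - χ1 x) * χ2 x, hη, hc, ?_, ?_, ?_⟩
  · intro x hx
    constructor
    · by_contra! hlt
      rw [← notMem_compl_iff] at hx
      apply hx
      rw [mem_compl_iff, notMem_tsupport_iff_eventuallyEq]
      have : ∀ᶠ y in nhds x, ‖y‖ < 1 / 2 := continuous_norm.continuousAt.eventually_lt_const hlt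
      filter_upwards [this] with y hy
      have : χ1 y = 1 := χ1.one_of_mem_closedBall (by rw [mem_closedBall_zero_iff]; exact hy.le)
      simp [this]
    · have := (tsupport_mul_subset_right (f := fun x => 1 - χ1 x) (g := χ2)) hx
      rw [χ2.tsupport_eq] at this
      simpa [mem_closedBall_zero_iff] using this
  · intro x hx1 hx2
    have e1 : ∀ᶠ y in nhds x, ‖y‖ < 5 / 2 := continuous_norm.continuousAt.eventually_lt_const hx2
    have e2 : ∀ᶠ y in nhds x, 3 / 4 < ‖y‖ :=
      continuous_norm.continuousAt.eventually_const_lt (lt_of_lt_of_le (by norm_num) hx1)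
    filter_upwards [e1, e2] with y hy1 hy2
    have a1 : χ2 y = 1 := χ2.one_of_mem_closedBall (by simpa [mem_closedBall_zero_iff] using hy1.le)
    have a2 : χ1 y = 0 := χ1.zero_of_le_dist (by simpa using hy2.le)
    simp [a1, a2]
  · have b1 : ∀ i, ∃ B, ∀ x, ‖pd i (fun x => (1 - χ1 x) * χ2 x) x‖ ≤ B := fun i =>
      (hasCompactSupport_pd i hc).exists_bound_of_continuous (contDiff_pd1 i hη).continuous
    have b2 : ∀ i j, ∃ B, ∀ x, ‖pd i (pd j (fun x => (1 - χ1 x) * χ2 x)) x‖ ≤ B := fun i j =>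
      (hasCompactSupport_pd i (hasCompactSupport_pd j hc)).exists_bound_of_continuous
        (continuous_pd i (contDiff_pd1 j hη))
    choose B1 hB1 using b1
    choose B2 hB2 using b2
    have hB1' : ∀ i, 0 ≤ B1 i := fun i => (norm_nonneg _).trans (hB1 i 0)
    have hB2' : ∀ i j, 0 ≤ B2 i j := fun i j => (norm_nonneg _).trans (hB2 i j 0)
    have n1 : 0 ≤ ∑ i, B1 i := Finset.sum_nonneg fun i _ => hB1' i
    have n2 : 0 ≤ ∑ i, ∑ j, B2 i j := Finset.sum_nonneg fun i _ => Finset.sum_nonneg fun j _ => hB2' i j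
    refine ⟨(∑ i, B1 i) + ∑ i, ∑ j, B2 i j, by positivity, ?_, ?_⟩
    · intro x i
      have := hB1 i x
      rw [Real.norm_eq_abs] at this
      have := Finset.single_le_sum (f := B1) (fun i _ => hB1' i) (Finset.mem_univ i)
      linarith
    · intro x i j
      have h0 := hB2 i j x
      rw [Real.norm_eq_abs] at h0
      have h3 := Finset.single_le_sum (f := fun j => B2 i j) (fun j _ => hB2' i j) (Finset.mem_univ j)
      have h4 := Finset.single_le_sum (f := fun i => ∑ j, B2 i j)
        (fun i _ => Finset.sum_nonneg fun j _ => hB2' i j) (Finset.mem_univ i)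
      linarith

theorem interp {P q τ1 C : ℝ} (hP : 0 < P) (hq : 0 < q) (hC : 0 < C) :
    ∃ N > 0, ∃ s : ℝ, 0 < s ∧ s < 1 ∧ ∀ E1 E2 E3 : ℝ, 0 ≤ E1 → 0 ≤ E2 → E2 ≤ E3 →
      (∀ τ ≥ τ1, E2 ≤ C * (Real.exp (τ * P) * E1 + Real.exp (-(τ * q)) * E3)) →
      E2 ≤ N * E1 ^ s * E3 ^ (1 - s) := by
  have hs0 : 0 < q / (P + q) := by positivity
  have hs1 : q / (P + q) < 1 := by rw [div_lt_one (by positivity)]; linarith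
  refine ⟨2 * C + Real.exp (τ1 * q), by positivity, q / (P + q), hs0, hs1, ?_⟩
  intro E1 E2 E3 h1 h2 h23 H
  have h3 : 0 ≤ E3 := h2.trans h23
  set s := q / (P + q) with hs
  rcases h1.eq_or_lt with h1 | h1
  · -- E1 = 0
    rw [← h1, Real.zero_rpow hs0.ne']
    simp only [mul_zero, zero_mul]
    have ht : Filter.Tendsto (fun τ : ℝ => C * (Real.exp (τ * P) * E1 + Real.exp (-(τ * q)) * E3))
        Filter.atTop (nhds (C * (0 + 0 * E3))) := by
      simp only [← h1, mul_zero]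
      refine Filter.Tendsto.const_mul _ (Filter.Tendsto.const_add _ (Filter.Tendsto.mul_const _ ?_))
      refine Real.tendsto_exp_neg_atTop_nhds_zero.comp ?_
      exact Filter.tendsto_id.atTop_mul_const hq
    have := ge_of_tendsto ht (Filter.eventually_atTop.2 ⟨τ1, H⟩)
    simpa using this
  rcases h3.eq_or_lt with h3 | h3
  · have : E2 ≤ 0 := by linarith
    refine this.trans ?_
    positivity
  have hlog1 : E1 ^ s * E3 ^ (1 - s) = Real.exp (s * Real.log E1 + (1 - s) * Real.log E3) := by
    rw [Real.rpow_def_of_pos h1, Real.rpow_def_of_pos h3, ← Real.exp_add]; ring_nf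
  have hX0 : 0 ≤ E1 ^ s * E3 ^ (1 - s) := by positivity
  have e1 : E1 = Real.exp (Real.log E1) := (Real.exp_log h1).symm
  have e3 : E3 = Real.exp (Real.log E3) := (Real.exp_log h3).symm
  have hPq : P + q ≠ 0 := by positivity
  have hsq : s * (P + q) = q := by rw [hs]; field_simp
  rw [mul_assoc]
  set l1 := Real.log E1
  set l3 := Real.log E3
  by_cases hτ : τ1 ≤ (l3 - l1) / (P + q)
  · have h := H _ hτ
    set τ := (l3 - l1) / (P + q) with hτd
    have hτm : τ * (P + q) = l3 - l1 := by rw [hτd]; field_simp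
    have a1 : Real.exp (τ * P) * E1 = E1 ^ s * E3 ^ (1 - s) := by
      rw [hlog1, e1, ← Real.exp_add]; congr 1
      have : τ * P = (1 - s) * (l3 - l1) := by
        rw [← hτm]; linear_combination τ * hsq
      linear_combination this
    have a2 : Real.exp (-(τ * q)) * E3 = E1 ^ s * E3 ^ (1 - s) := by
      rw [hlog1, e3, ← Real.exp_add]; congr 1
      have : τ * q = s * (l3 - l1) := by
        rw [← hτm]; linear_combination -τ * hsq
      linear_combination -this
    rw [a1, a2] at h
    have : 0 ≤ Real.exp (τ1 * q) * (E1 ^ s * E3 ^ (1 - s)) := by positivity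
    linarith
  · push Not at hτ
    rw [div_lt_iff₀ (by positivity)] at hτ
    have a1 : E3 ≤ Real.exp (τ1 * q) * (E1 ^ s * E3 ^ (1 - s)) := by
      rw [hlog1, ← Real.exp_add]
      nth_rw 1 [e3]
      apply Real.exp_le_exp.2
      have h5 : s * (l3 - l1) ≤ s * (τ1 * (P + q)) := by gcongr
      have h6 : s * (τ1 * (P + q)) = τ1 * q := by linear_combination τ1 * hsq
      linarith
    have : 0 ≤ 2 * C * (E1 ^ s * E3 ^ (1 - s)) := by positivity
    linarith

def dens (W : EuclideanSpace ℝ (Fin n) → ℝ) (x : EuclideanSpace ℝ (Fin n)) : ℝ :=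
  W x ^ 2 + ∑ i, pd i W x ^ 2

theorem dens_nonneg (W : EuclideanSpace ℝ (Fin n) → ℝ) (x) : 0 ≤ dens W x :=
  add_nonneg (sq_nonneg _) (Finset.sum_nonneg fun _ _ => sq_nonneg _)

theorem continuous_dens {W : EuclideanSpace ℝ (Fin n) → ℝ} (hW : ContDiff ℝ 2 W) :
    Continuous (dens W) := by
  have hcpd : ∀ i, Continuous (pd i W) := fun i => (contDiff_pd1 i hW).continuous
  have := hW.continuous
  unfold dens
  fun_prop

theorem integrable_dens {W : EuclideanSpace ℝ (Fin n) → ℝ} (hW : ContDiff ℝ 2 W) (c) (ρ : ℝ) :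
    IntegrableOn (dens W) (ball c ρ) :=
  ((continuous_dens hW).continuousOn.integrableOn_compact
    (isCompact_closedBall c ρ)).mono_set ball_subset_closedBall

theorem Lop_cut_bound {a : Fin n → Fin n → EuclideanSpace ℝ (Fin n) → ℝ}
    (ha : ∀ i j, ContDiff ℝ 1 (a i j)) {η W : EuclideanSpace ℝ (Fin n) → ℝ}
    (hη : ContDiff ℝ 2 η) (hW : ContDiff ℝ 2 W) {B M Λ : ℝ} {x : EuclideanSpace ℝ (Fin n)}
    (hB1 : ∀ i, |pd i η x| ≤ B) (hB2 : ∀ i j, |pd i (pd j η) x| ≤ B)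
    (hM : ∀ i j, |a i j x| ≤ M) (hM' : ∀ k i j, |pd k (a i j) x| ≤ M)
    (hL : |Lop a W x| ≤ Λ * |W x|) :
    Lop a (fun y => η y * W y) x ^ 2 ≤
      2 * Λ ^ 2 * (η x * W x) ^ 2 + 16 * (n ^ 2 * M * B) ^ 2 * dens W x := by
  rw [Lop_mul ha hη hW]
  set P : ℝ := Real.sqrt (∑ i, pd i W x ^ 2) with hP
  have hP2 : ∑ i, pd i W x ^ 2 = P ^ 2 := by
    rw [hP, Real.sq_sqrt]; exact Finset.sum_nonneg fun i _ => sq_nonneg _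
  have hp : ∀ i, |pd i W x| ≤ P := by
    intro i
    refine Real.abs_le_sqrt ?_
    exact Finset.single_le_sum (f := fun i => pd i W x ^ 2) (fun i _ => sq_nonneg _) (Finset.mem_univ i)
  have x1 : |∑ i, ∑ j, a i j x * (pd i η x * pd j W x + pd j η x * pd i W x)| ≤
      n * (n * (M * (B * P + B * P))) := by
    refine abs_sum_le_card fun i => abs_sum_le_card fun j => abs_mul_le (hM i j) ?_
    exact (abs_add_le _ _).trans (add_le_add (abs_mul_le (hB1 i) (hp j)) (abs_mul_le (hB1 j) (hp i)))
  have x2 : |Lop a η x| ≤ n * (n * (M * B + M * B)) := by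
    refine abs_sum_le_card fun i => abs_sum_le_card fun j => ?_
    rw [pd_mul i ((ha i j).differentiable (by norm_num) x)
      ((contDiff_pd1 j hη).differentiable (by norm_num) x)]
    exact (abs_add_le _ _).trans (add_le_add (abs_mul_le (hM' i i j) (hB1 j)) (abs_mul_le (hM i j) (hB2 i j)))
  set X := ∑ i, ∑ j, a i j x * (pd i η x * pd j W x + pd j η x * pd i W x)
  set Y := Lop a η x
  set L := Lop a W x
  have s0 : L ^ 2 ≤ Λ ^ 2 * W x ^ 2 := by
    have h := pow_le_pow_left₀ (abs_nonneg _) hL 2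
    rw [sq_abs, mul_pow, sq_abs] at h; exact h
  have s1 : X ^ 2 ≤ 4 * (n ^ 2 * M * B) ^ 2 * P ^ 2 := by
    have h := pow_le_pow_left₀ (abs_nonneg _) x1 2
    rw [sq_abs] at h; refine h.trans (le_of_eq (by ring))
  have s2 : Y ^ 2 ≤ 4 * (n ^ 2 * M * B) ^ 2 := by
    have h := pow_le_pow_left₀ (abs_nonneg _) x2 2
    rw [sq_abs] at h; refine h.trans (le_of_eq (by ring))
  have t1 := add_sq_le (a := η x * L) (b := X + W x * Y)
  have t2 := add_sq_le (a := X) (b := W x * Y)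
  have t3 : η x ^ 2 * L ^ 2 ≤ η x ^ 2 * (Λ ^ 2 * W x ^ 2) := by gcongr
  have t4 : W x ^ 2 * Y ^ 2 ≤ W x ^ 2 * (4 * (n ^ 2 * M * B) ^ 2) := by gcongr
  unfold dens
  rw [hP2]
  rw [add_assoc (η x * L)]
  rw [mul_pow] at t1 t2
  rw [mul_pow]
  linarith

theorem phi_le {α ρ : ℝ} (hα : 0 ≤ α) (hρ : 0 ≤ ρ) {x : EuclideanSpace ℝ (Fin n)} (h : ρ ≤ ‖x‖) :
    phi α x ≤ Real.exp (-α * ρ ^ 2) := by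
  unfold phi
  rw [norm_sq_sum]
  apply Real.exp_le_exp.2
  have : ρ ^ 2 ≤ ‖x‖ ^ 2 := by gcongr
  have := mul_le_mul_of_nonneg_left this hα
  linarith

theorem le_phi {α ρ : ℝ} (hα : 0 ≤ α) {x : EuclideanSpace ℝ (Fin n)} (h : ‖x‖ ≤ ρ) :
    Real.exp (-α * ρ ^ 2) ≤ phi α x := by
  unfold phi
  rw [norm_sq_sum]
  apply Real.exp_le_exp.2
  have : ‖x‖ ^ 2 ≤ ρ ^ 2 := by gcongr
  have := mul_le_mul_of_nonneg_left this hα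
  linarith


theorem pd_congr {f g : EuclideanSpace ℝ (Fin n) → ℝ} {x} (h : f =ᶠ[nhds x] g) (i) :
    pd i f x = pd i g x := by
  unfold pd; rw [h.fderiv_eq]

theorem pd_congr_ev {f g : EuclideanSpace ℝ (Fin n) → ℝ} {x} (h : f =ᶠ[nhds x] g) (i) :
    pd i f =ᶠ[nhds x] pd i g := by
  filter_upwards [h.eventuallyEq_nhds] with y hy using pd_congr hy i

theorem Lop_congr {a b : Fin n → Fin n → EuclideanSpace ℝ (Fin n) → ℝ}
    {f g : EuclideanSpace ℝ (Fin n) → ℝ} {x} (hab : ∀ i j, a i j =ᶠ[nhds x] b i j)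
    (h : f =ᶠ[nhds x] g) : Lop a f x = Lop b g x := by
  unfold Lop
  refine Finset.sum_congr rfl fun i _ => Finset.sum_congr rfl fun j _ => ?_
  apply pd_congr
  filter_upwards [hab i j, pd_congr_ev h j] with y h1 h2
  rw [h1, h2]

theorem dens_congr {f g : EuclideanSpace ℝ (Fin n) → ℝ} {x} (h : f =ᶠ[nhds x] g) :
    dens f x = dens g x := by
  unfold dens
  rw [h.eq_of_nhds]
  simp only [pd_congr h]

theorem dens_zero_of_notMem {u : EuclideanSpace ℝ (Fin n) → ℝ} {x} (hx : x ∉ tsupport u) :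
    dens u x = 0 := by
  unfold dens
  rw [image_eq_zero_of_notMem_tsupport hx]
  simp [pd_zero_of_notMem hx]

set_option maxHeartbeats 1600000 in
theorem three_balls_unit (n : ℕ) {lam M Λ : ℝ} (hlam : 0 < lam) (hM0 : 0 ≤ M) (hΛ : 0 ≤ Λ) :
    ∃ N > 0, ∃ s : ℝ, 0 < s ∧ s < 1 ∧
      ∀ (a : Fin n → Fin n → EuclideanSpace ℝ (Fin n) → ℝ)
      (_ : ∀ i j, ContDiff ℝ 1 (a i j)) (_ : ∀ i j x, a i j x = a j i x)
      (W : EuclideanSpace ℝ (Fin n) → ℝ) (_ : ContDiff ℝ 2 W)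
      (_ : ∀ x ∈ ball (0 : EuclideanSpace ℝ (Fin n)) (29 / 10), (∀ i j, |a i j x| ≤ M) ∧
        (∀ k i j, |pd k (a i j) x| ≤ M) ∧
        (∀ ξ : Fin n → ℝ, lam * ∑ i, ξ i ^ 2 ≤ ∑ i, ∑ j, a i j x * (ξ i * ξ j)) ∧
        |Lop a W x| ≤ Λ * |W x|),
      ∫ x in ball (0 : EuclideanSpace ℝ (Fin n)) 2, dens W x ≤
        N * (∫ x in ball (0 : EuclideanSpace ℝ (Fin n)) 1, dens W x) ^ s *
          (∫ x in ball (0 : EuclideanSpace ℝ (Fin n)) (29 / 10), dens W x) ^ (1 - s) := by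
  obtain ⟨α, hα, C, hC, τ0, hτ0, HC⟩ := carleman n hlam hM0
  obtain ⟨η, hη, hηc, hηs, hη1, B, hB, hB1, hB2⟩ := exists_cutoff n
  set f1 := Real.exp (-α * (1 / 2) ^ 2) with hf1
  set f2 := Real.exp (-α * 2 ^ 2) with hf2
  set f3 := Real.exp (-α * (5 / 2) ^ 2) with hf3
  have h12 : f2 < f1 := by apply Real.exp_lt_exp.2; nlinarith
  have h23 : f3 < f2 := by apply Real.exp_lt_exp.2; nlinarith
  set K : ℝ := 16 * (n ^ 2 * M * B) ^ 2 with hK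
  have hK0 : 0 ≤ K := by positivity
  obtain ⟨N, hN, s, hs0, hs1, H⟩ := interp (P := 2 * (f1 - f2)) (q := 2 * (f2 - f3))
    (τ1 := τ0 + 4 * C * Λ ^ 2) (C := 1 + 2 * C * K) (by linarith) (by linarith) (by positivity)
  refine ⟨N, hN, s, hs0, hs1, ?_⟩
  intro a ha hsym W hW hx
  have hnn : ∀ ρ, 0 ≤ ∫ x in ball (0 : EuclideanSpace ℝ (Fin n)) ρ, dens W x := fun ρ =>
    integral_nonneg fun x => dens_nonneg W x
  refine H _ _ _ (hnn 1) (hnn 2) ?_ ?_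
  · refine setIntegral_mono_set (integrable_dens hW 0 _) (Filter.Eventually.of_forall fun x => dens_nonneg W x) ?_
    exact (ball_subset_ball (by norm_num)).eventuallyLE
  intro τ hτ
  set v : EuclideanSpace ℝ (Fin n) → ℝ := fun y => η y * W y with hv
  have hvC : ContDiff ℝ 2 v := hη.mul hW
  have hvc : HasCompactSupport v := hηc.mul_right
  have hvs : ∀ x ∈ tsupport v, 1 / 2 ≤ ‖x‖ ∧ ‖x‖ ≤ 14 / 5 := fun x hx =>
    hηs x (tsupport_mul_subset_left hx)
  have hvb : ∀ x ∈ tsupport v, x ∈ ball (0 : EuclideanSpace ℝ (Fin n)) (29 / 10) := fun x hx => by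
    rw [mem_ball_zero_iff]; linarith [(hvs x hx).2]
  have hC4 : 0 ≤ 4 * C * Λ ^ 2 := by positivity
  have hτ00 : τ0 ≤ τ := by linarith
  have hcar := HC a ha hsym v hvC hvc (fun x hxv => ⟨(hvs x hxv).1, by linarith [(hvs x hxv).2],
    (hx x (hvb x hxv)).1, (hx x (hvb x hxv)).2.1, (hx x (hvb x hxv)).2.2.1⟩) τ hτ00
  have hτp : 0 ≤ τ := by linarith
  change τ * ∫ x, Real.exp (τ * phi α x) ^ 2 * dens v x ≤ _ at hcar
  set I1 := indicator (ball (0 : EuclideanSpace ℝ (Fin n)) 1) (dens W) with hI1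
  set I2 := indicator (ball (0 : EuclideanSpace ℝ (Fin n)) 2) (dens W) with hI2
  set I3 := indicator (ball (0 : EuclideanSpace ℝ (Fin n)) (29 / 10)) (dens W) with hI3
  have nI1 : ∀ x, 0 ≤ I1 x := fun x => indicator_nonneg (fun x _ => dens_nonneg W x) x
  have nI3 : ∀ x, 0 ≤ I3 x := fun x => indicator_nonneg (fun x _ => dens_nonneg W x) x
  have iI1 : Integrable I1 := (integrable_dens hW 0 _).integrable_indicator measurableSet_ball
  have iI2 : Integrable I2 := (integrable_dens hW 0 _).integrable_indicator measurableSet_ball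
  have iI3 : Integrable I3 := (integrable_dens hW 0 _).integrable_indicator measurableSet_ball
  have EI1 : ∫ x in ball (0 : EuclideanSpace ℝ (Fin n)) 1, dens W x = ∫ x, I1 x :=
    (integral_indicator measurableSet_ball).symm
  have EI2 : ∫ x in ball (0 : EuclideanSpace ℝ (Fin n)) 2, dens W x = ∫ x, I2 x :=
    (integral_indicator measurableSet_ball).symm
  have EI3 : ∫ x in ball (0 : EuclideanSpace ℝ (Fin n)) (29 / 10), dens W x = ∫ x, I3 x :=
    (integral_indicator measurableSet_ball).symm
  rw [EI1, EI2, EI3]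
  have hexpc : Continuous (fun x : EuclideanSpace ℝ (Fin n) => Real.exp (τ * phi α x)) :=
    (contDiff_exp_phi τ α (m := 0)).continuous
  have iL : Integrable (fun x => Real.exp (τ * phi α x) ^ 2 * Lop a v x ^ 2) := by
    refine ((hexpc.pow 2).mul ((continuous_Lop ha hvC).pow 2)).integrable_of_hasCompactSupport ?_
    refine HasCompactSupport.intro hvc fun x hx => ?_
    simp [Lop_zero_of_notMem hx]
  have iD : Integrable (fun x => Real.exp (τ * phi α x) ^ 2 * dens v x) := by
    refine ((hexpc.pow 2).mul (continuous_dens hvC)).integrable_of_hasCompactSupport ?_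
    refine HasCompactSupport.intro hvc fun x hx => ?_
    simp [dens_zero_of_notMem hx]
  have hveq : ∀ x, 1 ≤ ‖x‖ → ‖x‖ < 5 / 2 → v =ᶠ[nhds x] W := by
    intro x h1 h2
    filter_upwards [hη1 x h1 h2] with y hy
    simp [hv, hy]
  set e1 := Real.exp (τ * f1) ^ 2 with he1
  set e2 := Real.exp (τ * f2) ^ 2 with he2
  set e3 := Real.exp (τ * f3) ^ 2 with he3
  have vd : ∀ x, v x ^ 2 ≤ dens v x := fun x => by
    have : 0 ≤ ∑ i, pd i v x ^ 2 := Finset.sum_nonneg fun i _ => sq_nonneg _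
    unfold dens; linarith
  have pw1 : ∀ x, Real.exp (τ * phi α x) ^ 2 * Lop a v x ^ 2 ≤
      2 * Λ ^ 2 * (Real.exp (τ * phi α x) ^ 2 * dens v x) + K * (e1 * I1 x + e3 * I3 x) := by
    intro x
    have p1 : 0 ≤ K * (e1 * I1 x) := mul_nonneg hK0 (mul_nonneg (by positivity) (nI1 x))
    have p3 : 0 ≤ K * (e3 * I3 x) := mul_nonneg hK0 (mul_nonneg (by positivity) (nI3 x))
    have p2 : 0 ≤ 2 * Λ ^ 2 * (Real.exp (τ * phi α x) ^ 2 * dens v x) :=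
      mul_nonneg (by positivity) (mul_nonneg (by positivity) (dens_nonneg v x))
    by_cases hxs : x ∈ tsupport v
    swap
    · rw [Lop_zero_of_notMem hxs]
      linarith
    have hb := hvb x hxs
    have hxx := hx x hb
    have hcut := Lop_cut_bound ha hη hW (hB1 x) (hB2 x) hxx.1 hxx.2.1 hxx.2.2.2
    have hcut' : Lop a v x ^ 2 ≤ 2 * Λ ^ 2 * dens v x + K * dens W x := by
      refine hcut.trans ?_
      have := mul_le_mul_of_nonneg_left (vd x) (show 0 ≤ 2 * Λ ^ 2 by positivity)
      simp only [hv] at this ⊢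
      linarith
    have hcut2 := mul_le_mul_of_nonneg_left hcut' (sq_nonneg (Real.exp (τ * phi α x)))
    have hd := dens_nonneg W x
    by_cases c1 : ‖x‖ < 1
    · have : I1 x = dens W x := indicator_of_mem (by rw [mem_ball_zero_iff]; exact c1) _
      have hle : Real.exp (τ * phi α x) ^ 2 ≤ e1 := by
        apply pow_le_pow_left₀ (Real.exp_pos _).le
        apply Real.exp_le_exp.2
        exact mul_le_mul_of_nonneg_left (phi_le hα.le (by norm_num) (hvs x hxs).1) hτp
      have h5 := mul_le_mul_of_nonneg_right hle (mul_nonneg hK0 hd)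
      rw [this] at p1 ⊢
      linarith
    by_cases c2 : ‖x‖ < 5 / 2
    · have hq := hveq x (not_lt.1 c1) c2
      have hl : Lop a v x ^ 2 ≤ Λ ^ 2 * dens v x := by
        rw [Lop_congr (fun i j => Filter.EventuallyEq.rfl) hq]
        have h := pow_le_pow_left₀ (abs_nonneg _) hxx.2.2.2 2
        rw [sq_abs, mul_pow, sq_abs, ← hq.eq_of_nhds] at h
        exact h.trans (mul_le_mul_of_nonneg_left (vd x) (sq_nonneg _))
      have hl2 := mul_le_mul_of_nonneg_left hl (sq_nonneg (Real.exp (τ * phi α x)))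
      linarith
    · have : I3 x = dens W x := indicator_of_mem hb _
      have hle : Real.exp (τ * phi α x) ^ 2 ≤ e3 := by
        apply pow_le_pow_left₀ (Real.exp_pos _).le
        apply Real.exp_le_exp.2
        exact mul_le_mul_of_nonneg_left (phi_le hα.le (by norm_num) (not_lt.1 c2)) hτp
      have h5 := mul_le_mul_of_nonneg_right hle (mul_nonneg hK0 hd)
      rw [this] at p3 ⊢
      linarith
  have pw2 : ∀ x, e2 * (I2 x - I1 x) ≤ Real.exp (τ * phi α x) ^ 2 * dens v x := by
    intro x
    have hr : 0 ≤ Real.exp (τ * phi α x) ^ 2 * dens v x := mul_nonneg (by positivity) (dens_nonneg v x)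
    by_cases c1 : ‖x‖ < 1
    · have a1 : I1 x = dens W x := indicator_of_mem (by rw [mem_ball_zero_iff]; exact c1) _
      have a2 : I2 x = dens W x := indicator_of_mem (by rw [mem_ball_zero_iff]; linarith) _
      rw [a1, a2]; simpa using hr
    have a1 : I1 x = 0 := indicator_of_notMem (by rw [mem_ball_zero_iff]; exact c1) _
    by_cases c2 : ‖x‖ < 2
    · have a2 : I2 x = dens W x := indicator_of_mem (by rw [mem_ball_zero_iff]; exact c2) _
      rw [a1, a2, sub_zero, dens_congr (hveq x (not_lt.1 c1) (by linarith))]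
      refine mul_le_mul_of_nonneg_right ?_ (dens_nonneg W x)
      apply pow_le_pow_left₀ (Real.exp_pos _).le
      apply Real.exp_le_exp.2
      exact mul_le_mul_of_nonneg_left (le_phi hα.le c2.le) hτp
    · have a2 : I2 x = 0 := indicator_of_notMem (by rw [mem_ball_zero_iff]; exact c2) _
      rw [a1, a2]; simpa using hr
  have int1 := integral_mono iL ((iD.const_mul (2 * Λ ^ 2)).add
    (((iI1.const_mul e1).add (iI3.const_mul e3)).const_mul K)) pw1
  rw [integral_add' (iD.const_mul (2 * Λ ^ 2)) (((iI1.const_mul e1).add (iI3.const_mul e3)).const_mul K),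
    integral_const_mul, integral_const_mul, integral_add' (iI1.const_mul e1) (iI3.const_mul e3),
    integral_const_mul, integral_const_mul] at int1
  have int2 := integral_mono ((iI2.sub iI1).const_mul e2) iD pw2
  have int2e : (∫ x, e2 * (I2 - I1) x) = e2 * ((∫ x, I2 x) - ∫ x, I1 x) := by
    rw [integral_const_mul, integral_sub' iI2 iI1]
  rw [int2e] at int2
  have nJ : 0 ≤ ∫ x, Real.exp (τ * phi α x) ^ 2 * dens v x :=
    integral_nonneg fun x => mul_nonneg (by positivity) (dens_nonneg v x)
  have n1 : 0 ≤ ∫ x, I1 x := integral_nonneg nI1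
  have n3 : 0 ≤ ∫ x, I3 x := integral_nonneg nI3
  clear_value I1 I2 I3
  set J := ∫ x, Real.exp (τ * phi α x) ^ 2 * dens v x
  set E1 := ∫ x, I1 x
  set E2 := ∫ x, I2 x
  set E3 := ∫ x, I3 x
  set LL := ∫ x, Real.exp (τ * phi α x) ^ 2 * Lop a v x ^ 2
  have k1 : C * LL ≤ C * (2 * Λ ^ 2 * J + K * (e1 * E1 + e3 * E3)) :=
    mul_le_mul_of_nonneg_left int1 hC.le
  have k2 : (1 + 4 * C * Λ ^ 2) * J ≤ τ * J := mul_le_mul_of_nonneg_right (by linarith) nJ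
  have k4 : 0 ≤ C * Λ ^ 2 * J := by positivity
  have k3 : J ≤ C * (K * (e1 * E1 + e3 * E3)) := by linarith
  have r1 : e1 = e2 * Real.exp (τ * (2 * (f1 - f2))) := by
    rw [he1, he2, ← Real.exp_nat_mul, ← Real.exp_nat_mul, ← Real.exp_add]; congr 1; push_cast; ring
  have r3 : e3 = e2 * Real.exp (-(τ * (2 * (f2 - f3)))) := by
    rw [he3, he2, ← Real.exp_nat_mul, ← Real.exp_nat_mul, ← Real.exp_add]; congr 1; push_cast; ring
  have he2p : 0 < e2 := by positivity
  rw [r1, r3] at k3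
  have x1 : 1 ≤ Real.exp (τ * (2 * (f1 - f2))) := by
    apply Real.one_le_exp; exact mul_nonneg hτp (by linarith)
  have x3 : 0 ≤ Real.exp (-(τ * (2 * (f2 - f3)))) := (Real.exp_pos _).le
  set X1 := Real.exp (τ * (2 * (f1 - f2)))
  set X3 := Real.exp (-(τ * (2 * (f2 - f3))))
  have k5 : e2 * (E2 - E1) ≤ e2 * (C * K * (X1 * E1 + X3 * E3)) := by
    refine (int2.trans k3).trans (le_of_eq (by ring))
  have k6 := le_of_mul_le_mul_left k5 he2p
  have y1 : E1 ≤ X1 * E1 := le_mul_of_one_le_left n1 x1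
  have y3 : 0 ≤ X3 * E3 := mul_nonneg x3 n3
  have y4 : 0 ≤ C * K * (X1 * E1 + X3 * E3) := by positivity
  linarith


theorem abs_pd_le (f : EuclideanSpace ℝ (Fin n) → ℝ) (x) (k) : |pd k f x| ≤ ‖fderiv ℝ f x‖ := by
  unfold pd
  have := (fderiv ℝ f x).le_opNorm (EuclideanSpace.single k 1)
  simpa using this

theorem exists_bounds {Ω : Set (EuclideanSpace ℝ (Fin n))} (hΩo : IsOpen Ω)
    (hΩb : Bornology.IsBounded Ω) {f : EuclideanSpace ℝ (Fin n) → ℝ}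
    (hf : ContDiffOn ℝ 1 f (closure Ω)) :
    ∃ M ≥ 0, ∀ x ∈ Ω, |f x| ≤ M ∧ ∀ k, |pd k f x| ≤ M := by
  have hK : IsCompact (closure Ω) := hΩb.isCompact_closure
  have key : ∃ M ≥ 0, ∀ x ∈ closure Ω, x ∈ Ω → |f x| ≤ M ∧ ∀ k, |pd k f x| ≤ M := by
    refine hK.induction_on (p := fun t => ∃ M ≥ (0 : ℝ), ∀ x ∈ t, x ∈ Ω → |f x| ≤ M ∧ ∀ k, |pd k f x| ≤ M)
      ⟨0, le_rfl, by simp⟩ ?_ ?_ ?_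
    · rintro s t hst ⟨M, h0, hM⟩
      exact ⟨M, h0, fun x hx => hM x (hst hx)⟩
    · rintro s t ⟨M, h0, hM⟩ ⟨M', h0', hM'⟩
      refine ⟨M + M', by positivity, ?_⟩
      rintro x (hx | hx) hxΩ
      · have := hM x hx hxΩ
        exact ⟨by linarith [this.1], fun k => by linarith [this.2 k]⟩
      · have := hM' x hx hxΩ
        exact ⟨by linarith [this.1], fun k => by linarith [this.2 k]⟩
    · intro x hx
      have h1 : ContDiffWithinAt ℝ (0 + 1) f (closure Ω) x := by simpa using hf x hx
      obtain ⟨u, hu, -, f', hf', hc⟩ := (contDiffWithinAt_succ_iff_hasFDerivWithinAt (by simp)).1 h1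
      rw [insert_eq_of_mem hx] at hu
      have hxu : x ∈ u := mem_of_mem_nhdsWithin hx hu
      have c1 : ∀ᶠ z in nhdsWithin x u, ‖f' z‖ < ‖f' x‖ + 1 :=
        hc.continuousWithinAt.norm.eventually_lt_const (lt_add_one _)
      have c2 : ∀ᶠ z in nhdsWithin x (closure Ω), |f z| < |f x| + 1 :=
        h1.continuousWithinAt.abs.eventually_lt_const (lt_add_one _)
      obtain ⟨V, hVo, hxV, hV⟩ := mem_nhdsWithin.1 hu
      have c3 : ∀ᶠ z in nhdsWithin x (closure Ω), ‖f' z‖ < ‖f' x‖ + 1 :=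
        nhdsWithin_le_of_mem hu c1
      have c4 : ∀ᶠ z in nhdsWithin x (closure Ω), z ∈ V :=
        nhdsWithin_le_nhds (hVo.mem_nhds hxV)
      refine ⟨_, (c2.and (c3.and c4)), |f x| + 1 + (‖f' x‖ + 1), by positivity, ?_⟩
      rintro z ⟨h2, h3, h4⟩ hzΩ
      have hun : u ∈ nhds z := by
        filter_upwards [hVo.mem_nhds h4, hΩo.mem_nhds hzΩ] with p hp1 hp2
        exact hV ⟨hp1, subset_closure hp2⟩
      have hfd := ((hf' z (mem_of_mem_nhds hun)).hasFDerivAt hun).fderiv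
      refine ⟨by linarith [norm_nonneg (f' x)], fun k => ?_⟩
      have := abs_pd_le f z k
      rw [hfd] at this
      linarith [abs_nonneg (f x)]
  obtain ⟨M, h0, hM⟩ := key
  exact ⟨M, h0, fun x hx => hM x (subset_closure hx) hx⟩

theorem closedBall_sub_dom {Ω : Set (EuclideanSpace ℝ (Fin n))} {y} (hy : y ∈ Ω) {ρ : ℝ}
    (hρ : ρ < infDist y (frontier Ω)) : closedBall y ρ ⊆ Ω := by
  intro z hz
  by_contra hzΩ
  have hne : Ω ≠ univ := fun h => hzΩ (h ▸ mem_univ z)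
  obtain ⟨p, hp, he⟩ := exists_mem_frontier_infDist_compl_eq_dist hy hne
  have h1 : infDist y Ωᶜ ≤ dist y z := infDist_le_dist_of_mem hzΩ
  have h2 : infDist y (frontier Ω) ≤ dist y p := infDist_le_dist_of_mem hp
  rw [mem_closedBall, dist_comm] at hz
  linarith

theorem infDist_bound {Ω : Set (EuclideanSpace ℝ (Fin n))} (hΩb : Bornology.IsBounded Ω) {y}
    (hy : y ∈ Ω) : infDist y (frontier Ω) ≤ diam (closure Ω) := by
  rcases (frontier Ω).eq_empty_or_nonempty with h | ⟨p, hp⟩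
  · rw [h, infDist_empty]; exact diam_nonneg
  · exact (infDist_le_dist_of_mem hp).trans
      (dist_le_diam_of_mem hΩb.closure (subset_closure hy) (frontier_subset_closure hp))

theorem contDiff_bump_mul {Ω : Set (EuclideanSpace ℝ (Fin n))} (hΩo : IsOpen Ω) {y}
    (χ : ContDiffBump (y : EuclideanSpace ℝ (Fin n))) (hχ : closedBall y χ.rOut ⊆ Ω) {m : ℕ}
    {f : EuclideanSpace ℝ (Fin n) → ℝ} (hf : ContDiffOn ℝ m f Ω) :
    ContDiff ℝ m (fun x => χ x * f x) := by
  rw [contDiff_iff_contDiffAt]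
  intro x
  by_cases hx : x ∈ Ω
  · exact (χ.contDiff.contDiffAt).mul (hf.contDiffAt (hΩo.mem_nhds hx))
  · have : x ∉ tsupport χ := by rw [χ.tsupport_eq]; exact fun h => hx (hχ h)
    rw [notMem_tsupport_iff_eventuallyEq] at this
    have h0 : (fun x => χ x * f x) =ᶠ[nhds x] fun _ => 0 := by
      filter_upwards [this] with z hz
      simp [hz]
    exact contDiffAt_const.congr_of_eventuallyEq h0

theorem bump_mul_eq {y : EuclideanSpace ℝ (Fin n)} (χ : ContDiffBump y)
    (f : EuclideanSpace ℝ (Fin n) → ℝ) {x} (hx : x ∈ ball y χ.rIn) :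
    (fun x => χ x * f x) =ᶠ[nhds x] f := by
  filter_upwards [isOpen_ball.mem_nhds hx] with z hz
  rw [χ.one_of_mem_closedBall (ball_subset_closedBall hz), one_mul]

theorem pd_rescale (f : EuclideanSpace ℝ (Fin n) → ℝ) (y : EuclideanSpace ℝ (Fin n)) (r : ℝ) (i x) :
    pd i (fun z => f (y + r • z)) x = r * pd i f (y + r • x) := by
  unfold pd
  have h := fderiv_comp_smul (𝕜 := ℝ) (f := fun z => f (y + z)) (x := x) r
  have h2 : (fun z => f (y + r • z)) = ((fun z => f (y + z)) <| r • ·) := rfl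
  rw [h2, h, fderiv_comp_add_left]
  simp

theorem Lop_rescale {a : Fin n → Fin n → EuclideanSpace ℝ (Fin n) → ℝ}
    (ha : ∀ i j, ContDiff ℝ 1 (a i j)) {u : EuclideanSpace ℝ (Fin n) → ℝ}
    (hu : ContDiff ℝ 2 u) (y : EuclideanSpace ℝ (Fin n)) (r : ℝ) (x) :
    Lop (fun i j z => a i j (y + r • z)) (fun z => u (y + r • z)) x = r ^ 2 * Lop a u (y + r • x) := by
  unfold Lop
  simp only [Finset.mul_sum]
  refine Finset.sum_congr rfl fun i _ => Finset.sum_congr rfl fun j _ => ?_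
  simp only [pd_rescale]
  rw [pd_rescale (fun z => a i j z * (r * pd j u z)) y r i x]
  have h1 : (fun z => a i j z * (r * pd j u z)) = fun z => r * (a i j z * pd j u z) := by
    funext z; ring
  rw [h1, pd_const_mul]
  · ring
  · exact ((ha i j).mul (contDiff_pd1 j hu)).differentiable (by norm_num) _

theorem integral_rescale (g : EuclideanSpace ℝ (Fin n) → ℝ) (y : EuclideanSpace ℝ (Fin n)) {r : ℝ}
    (hr : 0 < r) (ρ : ℝ) :
    ∫ x in ball (0 : EuclideanSpace ℝ (Fin n)) ρ, g (y + r • x) =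
      |(r ^ n)⁻¹| * ∫ z in ball y (ρ * r), g z := by
  rw [← integral_indicator measurableSet_ball, ← integral_indicator measurableSet_ball]
  have h1 : (fun x => (ball (0 : EuclideanSpace ℝ (Fin n)) ρ).indicator (fun x => g (y + r • x)) x) =
      fun x => (fun z => (ball y (ρ * r)).indicator g (y + z)) (r • x) := by
    funext x
    have : x ∈ ball (0 : EuclideanSpace ℝ (Fin n)) ρ ↔ y + r • x ∈ ball y (ρ * r) := by
      rw [mem_ball_zero_iff, mem_ball, dist_eq_norm, add_sub_cancel_left, norm_smul,
        Real.norm_of_nonneg hr.le, mul_comm, mul_lt_mul_iff_left₀ hr]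
    by_cases hx : x ∈ ball (0 : EuclideanSpace ℝ (Fin n)) ρ
    · simp only [indicator_of_mem hx, indicator_of_mem (this.1 hx)]
    · simp only [indicator_of_notMem hx, indicator_of_notMem (fun h => hx (this.2 h))]
  rw [h1, Measure.integral_comp_smul volume (fun z => (ball y (ρ * r)).indicator g (y + z)) r,
    integral_add_left_eq_self (fun z => (ball y (ρ * r)).indicator g z)]
  simp

theorem Lop_le_of_ae {Ω : Set (EuclideanSpace ℝ (Fin n))} {U : Set (EuclideanSpace ℝ (Fin n))}
    (hU : IsOpen U) (hUΩ : U ⊆ Ω)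
    {A a : Fin n → Fin n → EuclideanSpace ℝ (Fin n) → ℝ} {q w u : EuclideanSpace ℝ (Fin n) → ℝ} {Λ : ℝ}
    (hq : ∀ᵐ x ∂(volume.restrict Ω), |q x| ≤ Λ) (hsol : IsSolution A q w Ω)
    (ha : ∀ i j, ContDiff ℝ 1 (a i j)) (hu : ContDiff ℝ 2 u)
    (haA : ∀ x ∈ U, ∀ i j, a i j =ᶠ[nhds x] A i j) (huw : ∀ x ∈ U, u =ᶠ[nhds x] w) :
    ∀ x ∈ U, |Lop a u x| ≤ Λ * |u x| := by
  have hq' : ∀ᵐ x ∂(volume.restrict U), |q x| ≤ Λ := ae_restrict_of_ae_restrict_of_subset hUΩ hq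
  have c1 := continuous_Lop ha hu
  have c2 := hu.continuous
  have hae : (fun x => min (Λ * |u x| - |Lop a u x|) 0) =ᵐ[volume.restrict U] fun _ => 0 := by
    filter_upwards [hq', ae_restrict_mem hU.measurableSet] with x hx hxU
    rw [min_eq_right]
    have e := hsol x (hUΩ hxU)
    change Lop A w x + q x * w x = 0 at e
    rw [Lop_congr (haA x hxU) (huw x hxU), (huw x hxU).eq_of_nhds,
      show Lop A w x = -(q x * w x) by linarith, abs_neg, abs_mul]
    have := mul_le_mul_of_nonneg_right hx (abs_nonneg (w x))
    linarith
  have := Measure.eqOn_open_of_ae_eq hae hU (by fun_prop) (by fun_prop)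
  intro x hx
  have h := this hx
  simp only at h
  have := min_le_left (Λ * |u x| - |Lop a u x|) 0
  linarith


theorem final_alg {N R0 r F1 F2 F3 s : ℝ} (hN : 0 ≤ N) (hR : 0 ≤ R0) (hr : 0 ≤ r) (h1 : 0 ≤ F1)
    (h2 : 0 ≤ F2) (h3 : 0 ≤ F3) (h : r ^ 2 * F2 ≤ N * R0 ^ 4 * F1 ^ s * F3 ^ (1 - s)) :
    r * F2 ^ (1 / 2 : ℝ) ≤ (N * R0 ^ 4) ^ (1 / 2 : ℝ) * (F1 ^ (1 / 2 : ℝ)) ^ s *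
      (F3 ^ (1 / 2 : ℝ)) ^ (1 - s) := by
  have e := Real.rpow_le_rpow (by positivity) h (show (0 : ℝ) ≤ 1 / 2 by norm_num)
  have p1 : 0 ≤ F1 ^ s := Real.rpow_nonneg h1 _
  have p3 : 0 ≤ F3 ^ (1 - s) := Real.rpow_nonneg h3 _
  rw [Real.mul_rpow (by positivity) h2, Real.mul_rpow (by positivity) p3,
    Real.mul_rpow (by positivity) p1, ← Real.sqrt_eq_rpow (r ^ 2), Real.sqrt_sq hr] at e
  rw [← Real.rpow_mul h1, ← Real.rpow_mul h3, mul_comm (1 / 2) s, mul_comm (1 / 2) (1 - s),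
    Real.rpow_mul h1, Real.rpow_mul h3]
  exact e

theorem scale_alg {N R0 r c E1 E2 E3 F1 F2 F3 s : ℝ} (hN : 0 ≤ N) (hR : 1 ≤ R0)
    (hc : 0 < c) (hF1 : 0 ≤ F1) (hF3 : 0 ≤ F3) (hE1 : 0 ≤ E1) (hE3 : 0 ≤ E3) (hs0 : 0 < s) (hs1 : s < 1)
    (k1 : E1 ≤ c * (R0 ^ 2 * F1)) (k3 : E3 ≤ c * (R0 ^ 2 * F3))
    (k2 : c * (r ^ 2 * F2) ≤ R0 ^ 2 * E2) (h : E2 ≤ N * E1 ^ s * E3 ^ (1 - s)) :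
    r ^ 2 * F2 ≤ N * R0 ^ 4 * F1 ^ s * F3 ^ (1 - s) := by
  have a1 : E1 ^ s ≤ (c * R0 ^ 2) ^ s * F1 ^ s := by
    rw [← Real.mul_rpow (by positivity) hF1]
    exact Real.rpow_le_rpow hE1 (by linarith) hs0.le
  have a3 : E3 ^ (1 - s) ≤ (c * R0 ^ 2) ^ (1 - s) * F3 ^ (1 - s) := by
    rw [← Real.mul_rpow (by positivity) hF3]
    exact Real.rpow_le_rpow hE3 (by linarith) (by linarith)
  have p1 : 0 ≤ F1 ^ s := Real.rpow_nonneg hF1 _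
  have p3 : 0 ≤ F3 ^ (1 - s) := Real.rpow_nonneg hF3 _
  have hcs : (c * R0 ^ 2) ^ s * (c * R0 ^ 2) ^ (1 - s) = c * R0 ^ 2 := by
    rw [← Real.rpow_add (by positivity)]; simp
  have b : E2 ≤ N * (c * R0 ^ 2) * F1 ^ s * F3 ^ (1 - s) := by
    calc E2 ≤ N * E1 ^ s * E3 ^ (1 - s) := h
      _ ≤ N * ((c * R0 ^ 2) ^ s * F1 ^ s) * ((c * R0 ^ 2) ^ (1 - s) * F3 ^ (1 - s)) := by gcongr
      _ = N * ((c * R0 ^ 2) ^ s * (c * R0 ^ 2) ^ (1 - s)) * F1 ^ s * F3 ^ (1 - s) := by ring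
      _ = _ := by rw [hcs]
  have b2 : c * (r ^ 2 * F2) ≤ c * (N * R0 ^ 4 * F1 ^ s * F3 ^ (1 - s)) := by
    refine k2.trans ((mul_le_mul_of_nonneg_left b (by positivity)).trans (le_of_eq (by ring)))
  exact le_of_mul_le_mul_left b2 hc

theorem dens_rescale (u : EuclideanSpace ℝ (Fin n) → ℝ) (y : EuclideanSpace ℝ (Fin n)) (r : ℝ) (x) :
    dens (fun z => u (y + r • z)) x = u (y + r • x) ^ 2 + r ^ 2 * ∑ i, pd i u (y + r • x) ^ 2 := by
  unfold dens
  simp only [pd_rescale, mul_pow, Finset.mul_sum]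

theorem main_three {n : ℕ}
    (Ω : Set (EuclideanSpace ℝ (Fin n)))
    (hΩo : IsOpen Ω) (hΩb : Bornology.IsBounded Ω)
    (A : Fin n → Fin n → EuclideanSpace ℝ (Fin n) → ℝ) (hA : EllipticSym Ω A)
    (Λ : ℝ) (hΛ : 0 < Λ) :
    ∃ N > 0, ∃ s : ℝ, 0 < s ∧ s < 1 ∧
      ∀ q w : EuclideanSpace ℝ (Fin n) → ℝ,
        (∀ᵐ x ∂(volume.restrict Ω), |q x| ≤ Λ) →
        ContDiffOn ℝ 2 w Ω → IsSolution A q w Ω →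
        ∀ y ∈ Ω, ∀ r : ℝ, 0 < r → r < infDist y (frontier Ω) / 3 →
          r * H1Norm (ball y (2 * r)) w ≤
            N * (H1Norm (ball y r) w) ^ s * (H1Norm (ball y (3 * r)) w) ^ (1 - s) := by
  obtain ⟨hsym, hC1, lam, hlam, hell⟩ := hA
  have hb := fun i j => exists_bounds hΩo hΩb (hC1 i j)
  choose M hM0 hM using hb
  set MM : ℝ := ∑ i, ∑ j, M i j with hMM
  have hMle : ∀ i j, M i j ≤ MM := by
    intro i j
    have h3 := Finset.single_le_sum (f := fun j => M i j) (fun j _ => hM0 i j) (Finset.mem_univ j)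
    have h4 := Finset.single_le_sum (f := fun i => ∑ j, M i j)
        (fun i _ => Finset.sum_nonneg fun j _ => hM0 i j) (Finset.mem_univ i)
    exact h3.trans h4
  have hMM0 : 0 ≤ MM := Finset.sum_nonneg fun i _ => Finset.sum_nonneg fun j _ => hM0 i j
  clear_value MM
  set R0 : ℝ := diam (closure Ω) + 1 with hR0
  have hR1 : 1 ≤ R0 := by have : 0 ≤ diam (closure Ω) := diam_nonneg; linarith
  obtain ⟨N, hN, s, hs0, hs1, H⟩ := three_balls_unit n hlam (M := R0 * MM) (Λ := R0 ^ 2 * Λ)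
    (by positivity) (by positivity)
  refine ⟨(N * R0 ^ 4) ^ (1 / 2 : ℝ), by positivity, s, hs0, hs1, ?_⟩
  intro q w hq hw hsol y hy r hr hr3
  have hrR : r ≤ R0 := by
    have := infDist_bound hΩb hy
    have h0 : 0 ≤ infDist y (frontier Ω) := infDist_nonneg
    linarith
  have hsub : closedBall y (3 * r) ⊆ Ω := closedBall_sub_dom hy (by linarith)
  let χ : ContDiffBump y := ⟨29 / 10 * r, 3 * r, by positivity, by linarith⟩
  have hχ : closedBall y χ.rOut ⊆ Ω := hsub
  set a : Fin n → Fin n → EuclideanSpace ℝ (Fin n) → ℝ := fun i j x => χ x * A i j x with ha_def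
  set u : EuclideanSpace ℝ (Fin n) → ℝ := fun x => χ x * w x with hu_def
  have ha : ∀ i j, ContDiff ℝ 1 (a i j) := fun i j =>
    contDiff_bump_mul hΩo χ hχ (m := 1) ((hC1 i j).mono subset_closure)
  have hu : ContDiff ℝ 2 u := contDiff_bump_mul hΩo χ hχ (m := 2) hw
  have haeq : ∀ x ∈ ball y (29 / 10 * r), ∀ i j, a i j =ᶠ[nhds x] A i j := fun x hx i j =>
    bump_mul_eq χ (A i j) hx
  have hueq : ∀ x ∈ ball y (29 / 10 * r), u =ᶠ[nhds x] w := fun x hx => bump_mul_eq χ w hx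
  have hballsub : ball y (29 / 10 * r) ⊆ Ω :=
    ((ball_subset_ball (by linarith)).trans ball_subset_closedBall).trans hsub
  have hL := Lop_le_of_ae isOpen_ball hballsub hq hsol ha hu haeq hueq
  have hasym : ∀ i j x, a i j x = a j i x := by
    intro i j x
    simp only [ha_def]
    by_cases hx : x ∈ Ω
    · rw [hsym i j x (subset_closure hx)]
    · have : χ x = 0 := by
        apply χ.zero_of_le_dist
        by_contra! h
        exact hx (hχ (mem_closedBall.2 h.le))
      rw [this]; simp
  clear_value a u
  have hT : Continuous fun z : EuclideanSpace ℝ (Fin n) => y + r • z := by fun_prop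
  have hTc : ∀ m : WithTop ℕ∞, ContDiff ℝ m fun z : EuclideanSpace ℝ (Fin n) => y + r • z :=
    fun m => by fun_prop
  have hWC : ContDiff ℝ 2 (fun z => u (y + r • z)) := hu.comp (hTc 2)
  have hmem : ∀ x ∈ ball (0 : EuclideanSpace ℝ (Fin n)) (29 / 10), y + r • x ∈ ball y (29 / 10 * r) := by
    intro x hx
    rw [mem_ball_zero_iff] at hx
    rw [mem_ball, dist_eq_norm, add_sub_cancel_left, norm_smul, Real.norm_of_nonneg hr.le, mul_comm]
    exact mul_lt_mul_of_pos_right hx hr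
  have h := H (fun i j z => a i j (y + r • z)) (fun i j => (ha i j).comp (hTc 1))
    (fun i j x => hasym i j _) (fun z => u (y + r • z)) hWC ?_
  swap
  · intro x hx
    have hz := hmem x hx
    set z := y + r • x with hzd
    have hzΩ := hballsub hz
    refine ⟨fun i j => ?_, fun k i j => ?_, fun ξ => ?_, ?_⟩
    · rw [(haeq z hz i j).eq_of_nhds]
      refine ((hM i j z hzΩ).1.trans (hMle i j)).trans ?_
      exact le_mul_of_one_le_left hMM0 hR1
    · rw [pd_rescale, pd_congr (haeq z hz i j), abs_mul, abs_of_pos hr]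
      exact mul_le_mul hrR (((hM i j z hzΩ).2 k).trans (hMle i j)) (abs_nonneg _) (by positivity)
    · have := hell z hzΩ (WithLp.toLp 2 ξ)
      rw [EuclideanSpace.norm_sq_eq] at this
      simp only [Real.norm_eq_abs, sq_abs] at this
      refine this.trans (le_of_eq ?_)
      refine Finset.sum_congr rfl fun i _ => Finset.sum_congr rfl fun j _ => ?_
      rw [(haeq z hz i j).eq_of_nhds]; ring
    · rw [Lop_rescale ha hu, abs_mul, abs_of_nonneg (sq_nonneg r)]
      have h1 := hL z hz
      have h2 : r ^ 2 ≤ R0 ^ 2 := by gcongr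
      calc r ^ 2 * |Lop a u z| ≤ R0 ^ 2 * (Λ * |u z|) :=
            mul_le_mul h2 h1 (abs_nonneg _) (by positivity)
        _ = _ := by simp only [hzd]; ring
  -- integrals
  set g : EuclideanSpace ℝ (Fin n) → ℝ := fun z => u z ^ 2 + r ^ 2 * ∑ i, pd i u z ^ 2 with hg
  have hgd : (dens fun z => u (y + r • z)) = fun x => g (y + r • x) := by
    funext x; rw [dens_rescale]
  rw [hgd] at h
  rw [integral_rescale g y hr, integral_rescale g y hr, integral_rescale g y hr] at h
  set c : ℝ := |(r ^ n)⁻¹| with hc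
  have hc0 : 0 < c := by rw [hc]; positivity
  have hgc : Continuous g := by
    have hcpd : ∀ i, Continuous (pd i u) := fun i => (contDiff_pd1 i hu).continuous
    have := hu.continuous
    simp only [hg]; fun_prop
  have ig : ∀ ρ, IntegrableOn g (ball y ρ) := fun ρ =>
    (hgc.continuousOn.integrableOn_compact (isCompact_closedBall y ρ)).mono_set ball_subset_closedBall
  have hg0 : ∀ z, 0 ≤ g z := fun z => add_nonneg (sq_nonneg _)
    (mul_nonneg (sq_nonneg _) (Finset.sum_nonneg fun i _ => sq_nonneg _))
  have hgle : ∀ z, g z ≤ R0 ^ 2 * dens u z := by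
    intro z
    have h2 : r ^ 2 ≤ R0 ^ 2 := by gcongr
    have h3 : 1 ≤ R0 ^ 2 := one_le_pow₀ hR1
    have h4 : 0 ≤ ∑ i, pd i u z ^ 2 := Finset.sum_nonneg fun i _ => sq_nonneg _
    have h5 := mul_le_mul_of_nonneg_right h2 h4
    have h6 := mul_le_mul_of_nonneg_right h3 (sq_nonneg (u z))
    simp only [hg, dens]
    linarith
  have hgge : ∀ z, r ^ 2 * dens u z ≤ R0 ^ 2 * g z := by
    intro z
    have h2 : r ^ 2 ≤ R0 ^ 2 := by gcongr
    have h3 : 1 ≤ R0 ^ 2 := one_le_pow₀ hR1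
    have h4 : 0 ≤ r ^ 2 * ∑ i, pd i u z ^ 2 :=
      mul_nonneg (sq_nonneg _) (Finset.sum_nonneg fun i _ => sq_nonneg _)
    have h5 := mul_le_mul_of_nonneg_right h3 h4
    have h6 := mul_le_mul_of_nonneg_right h2 (sq_nonneg (u z))
    simp only [hg, dens]
    linarith
  have hFeq : ∀ ρ ≤ 29 / 10 * r, ∫ z in ball y ρ, dens u z =
      ∫ z in ball y ρ, (w z ^ 2 + ‖fderiv ℝ w z‖ ^ 2) := by
    intro ρ hρ
    refine setIntegral_congr_fun measurableSet_ball fun z hz => ?_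
    rw [dens_congr (hueq z (ball_subset_ball hρ hz)), norm_fderiv_sq]
    rfl
  have iw : IntegrableOn (fun z => w z ^ 2 + ‖fderiv ℝ w z‖ ^ 2) (ball y (3 * r)) := by
    refine (ContinuousOn.integrableOn_compact (isCompact_closedBall y (3 * r)) ?_).mono_set
      ball_subset_closedBall
    have d1 : ContinuousOn w (closedBall y (3 * r)) := hw.continuousOn.mono hsub
    have d2 : ContinuousOn (fderiv ℝ w) (closedBall y (3 * r)) :=
      (hw.continuousOn_fderiv_of_isOpen hΩo (by norm_num)).mono hsub
    exact (d1.pow 2).add (d2.norm.pow 2)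
  have hw0 : ∀ z, 0 ≤ w z ^ 2 + ‖fderiv ℝ w z‖ ^ 2 := fun z => by positivity
  have up : ∀ ρ, ∫ z in ball y ρ, g z ≤ R0 ^ 2 * ∫ z in ball y ρ, dens u z := by
    intro ρ
    rw [← integral_const_mul]
    exact integral_mono (ig ρ) ((integrable_dens hu y ρ).const_mul _) hgle
  have low : ∀ ρ, r ^ 2 * ∫ z in ball y ρ, dens u z ≤ R0 ^ 2 * ∫ z in ball y ρ, g z := by
    intro ρ
    rw [← integral_const_mul, ← integral_const_mul]
    exact integral_mono ((integrable_dens hu y ρ).const_mul _) ((ig ρ).const_mul _) hgge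
  have mono3 : ∫ z in ball y (29 / 10 * r), dens u z ≤
      ∫ z in ball y (3 * r), (w z ^ 2 + ‖fderiv ℝ w z‖ ^ 2) := by
    rw [hFeq _ le_rfl]
    refine setIntegral_mono_set iw (Filter.Eventually.of_forall hw0) ?_
    exact (ball_subset_ball (by linarith)).eventuallyLE
  rw [one_mul] at h
  have u1 := up r
  have u3 := (up (29 / 10 * r)).trans (mul_le_mul_of_nonneg_left mono3 (by positivity))
  have l2 := low (2 * r)
  rw [hFeq r (by linarith)] at u1
  rw [hFeq (2 * r) (by linarith)] at l2
  unfold H1Norm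
  refine final_alg hN.le (by linarith) hr.le (integral_nonneg hw0) (integral_nonneg hw0)
    (integral_nonneg hw0) ?_
  refine scale_alg hN.le hR1 hc0 (integral_nonneg hw0) (integral_nonneg hw0)
    (mul_nonneg hc0.le (integral_nonneg hg0)) (mul_nonneg hc0.le (integral_nonneg hg0)) hs0 hs1
    (mul_le_mul_of_nonneg_left u1 hc0.le) (mul_le_mul_of_nonneg_left u3 hc0.le) ?_ h
  have := mul_le_mul_of_nonneg_left l2 hc0.le
  linarith

end Helpers

theorem stmt_8 {n : ℕ} (hn : n = 2 ∨ n = 3)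
    (Ω : Set (EuclideanSpace ℝ (Fin n)))
    (hΩo : IsOpen Ω) (hΩb : Bornology.IsBounded Ω) (hΩc : IsConnected Ω)
    (A : Fin n → Fin n → EuclideanSpace ℝ (Fin n) → ℝ) (hA : EllipticSym Ω A)
    (Λ : ℝ) (hΛ : 0 < Λ) :
    ∃ N > 0, ∃ s : ℝ, 0 < s ∧ s < 1 ∧
      ∀ q w : EuclideanSpace ℝ (Fin n) → ℝ,
        Measurable q → (∀ᵐ x ∂(volume.restrict Ω), |q x| ≤ Λ) →
        ContDiffOn ℝ 2 w Ω → IsSolution A q w Ω →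
        ∀ y ∈ Ω, ∀ r : ℝ, 0 < r → r < infDist y (frontier Ω) / 3 →
          r * H1Norm (ball y (2 * r)) w ≤
            N * (H1Norm (ball y r) w) ^ s * (H1Norm (ball y (3 * r)) w) ^ (1 - s) := by
  obtain ⟨N, hN, s, hs0, hs1, H⟩ := main_three Ω hΩo hΩb A hA Λ hΛ
  exact ⟨N, hN, s, hs0, hs1, fun q w _ hq hw hsol => H q w hq hw hsol⟩
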